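/- arXiv:0810.3136 — 7 statements merged into one kernel-verified Lean document; each statement's English description precedes it below -/
import Mathlib

section
/- Let (N, v) be a coalitional game with transferable utility with n = |N| players. If the core of (N, v) is empty, i.e. there is no vector x ∈ ℝ^N with Σ_{i∈S} x_i ≥ v(S) for every nonempty coalition S ⊆ N and Σ_{i∈N} x_i ≤ v(N), then there exists a family 𝒮 of nonempty coalitions of N with |𝒮| ≤ n such that already the subsystem is infeasible: no x ∈ ℝ^N satisfies Σ_{i∈S} x_i ≥ v(S) for every S ∈ 𝒮 together with Σ_{i∈N} x_i ≤ v(N). -/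
/-- The demands of all nonempty coalitions can be met at once by giving
every player enough. -/
theorem exists_forall_nonempty_le_sum {N : Type*} [Fintype N] (v : Finset N → ℝ) :
    ∃ x : N → ℝ, ∀ S : Finset N, S.Nonempty → v S ≤ ∑ i ∈ S, x i := by
  refine ⟨fun _ => ∑ T, |v T|, fun S ⟨i, hi⟩ => ?_⟩
  have hM : 0 ≤ ∑ T, |v T| := Finset.sum_nonneg fun T _ => abs_nonneg _
  calc v S ≤ |v S| := le_abs_self _
    _ ≤ ∑ T, |v T| :=
        Finset.single_le_sum (f := fun T => |v T|) (fun T _ => abs_nonneg _) (Finset.mem_univ S)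
    _ ≤ ∑ _i ∈ S, ∑ T, |v T| :=
        Finset.single_le_sum (f := fun _ => ∑ T, |v T|) (fun _ _ => hM) hi

/-- The half-space of the game system: the efficiency constraint for `none`, the demand of the
coalition `S` for `some S`. -/
def coreHalfSpace {N : Type*} [Fintype N] (v : Finset N → ℝ) : Option (Finset N) → Set (N → ℝ)
  | none => {x | ∑ i, x i ≤ v Finset.univ}
  | some S => {x | v S ≤ ∑ i ∈ S, x i}

theorem convex_coreHalfSpace {N : Type*} [Fintype N] (v : Finset N → ℝ)
    (o : Option (Finset N)) : Convex ℝ (coreHalfSpace v o) := by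
  have hlin (S : Finset N) : IsLinearMap ℝ fun x : N → ℝ => ∑ i ∈ S, x i :=
    ⟨fun x y => by simp [Finset.sum_add_distrib], fun c x => by simp [Finset.mul_sum]⟩
  cases o with
  | none => exact convex_halfSpace_le (hlin Finset.univ) _
  | some S => exact convex_halfSpace_ge (hlin S) _

/--
**Certificate of emptiness for the core.**
Let `(N, v)` be a coalitional game with transferable utility with `n = |N|` players.
If the core of `(N, v)` is empty, i.e. there is no vector `x ∈ ℝ^N` with
`∑_{i∈S} x i ≥ v S` for every nonempty coalition `S ⊆ N` and `∑_{i∈N} x i ≤ v N`,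
then there exists a family `𝒮` of nonempty coalitions with `|𝒮| ≤ n` such that already
the subsystem is infeasible.
-/
theorem core_emptiness_certificate {N : Type*} [Fintype N] [DecidableEq N] [Nonempty N]
    (v : Finset N → ℝ)
    (hempty : ¬ ∃ x : N → ℝ,
      (∀ S : Finset N, S.Nonempty → v S ≤ ∑ i ∈ S, x i) ∧ (∑ i, x i) ≤ v Finset.univ) :
    ∃ 𝒮 : Finset (Finset N), 𝒮.card ≤ Fintype.card N ∧ (∀ S ∈ 𝒮, S.Nonempty) ∧
      ¬ ∃ x : N → ℝ,
        (∀ S ∈ 𝒮, v S ≤ ∑ i ∈ S, x i) ∧ (∑ i, x i) ≤ v Finset.univ := by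
  by_contra! hcert
  let s : Finset (Option (Finset N)) :=
    Finset.insertNone (Finset.univ.filter fun S : Finset N => S.Nonempty)
  have hs (S : Finset N) : some S ∈ s ↔ S.Nonempty := by simp [s]
  obtain ⟨x, hx⟩ : (⋂ o ∈ s, coreHalfSpace v o).Nonempty := by
    refine Convex.helly_theorem' (𝕜 := ℝ) (fun o _ => convex_coreHalfSpace v o)
      fun I hI hcard => ?_
    rw [Module.finrank_fintype_fun_eq_card] at hcard
    by_cases hnone : none ∈ I
    · have hcard' : (Finset.eraseNone I).card ≤ Fintype.card N := by
        rw [Finset.card_eraseNone_of_mem hnone]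
        omega
      obtain ⟨x, hx, hxN⟩ := hcert (Finset.eraseNone I) hcard'
        fun S hS => (hs S).1 (hI (Finset.mem_eraseNone.1 hS))
      refine ⟨x, Set.mem_iInter₂.2 ?_⟩
      rintro (_ | S) ho
      · exact hxN
      · exact hx S (Finset.mem_eraseNone.2 ho)
    · obtain ⟨x, hx⟩ := exists_forall_nonempty_le_sum v
      refine ⟨x, Set.mem_iInter₂.2 ?_⟩
      rintro (_ | S) ho
      · exact absurd ho hnone
      · exact hx S ((hs S).1 (hI ho))
  rw [Set.mem_iInter₂] at hx
  exact hempty ⟨x, fun S hS => hx (some S) ((hs S).2 hS), hx none (by simp [s])⟩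
end

section
/- Let 𝒮 be a finite set of closed halfspaces of ℝ^n whose intersection P = Pol(𝒮) has dimension n (i.e. the affine hull of P is all of ℝ^n), and let H_F⁺ be a supporting halfspace of P with touching set F = H_F ∩ P. Then there exists a subset ℋ_F ⊆ 𝒮 with |ℋ_F| ≤ n − dim(F) such that H_F⁺ is a supporting halfspace of the polyhedron Pol(ℋ_F), and the touching set C = H_F ∩ Pol(ℋ_F) satisfies F ⊆ C. -/
open scoped RealInnerProductSpace

open Classical in
/-- The dimension of a subset of `ℝ^n`: the dimension of its affine hull,
with `dim ∅ = -1`. -/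
noncomputable def setDim {n : ℕ} (A : Set (EuclideanSpace ℝ (Fin n))) : ℤ :=
  if A = ∅ then -1 else (Module.finrank ℝ (affineSpan ℝ A).direction : ℤ)

/-- **Carathéodory's theorem for cones**: a nonnegative combination of vectors is a positive
combination of a linearly independent subfamily. -/
theorem exists_linearIndepOn_pos_sum_smul {ι E : Type*} [AddCommGroup E] [Module ℝ E]
    (v : ι → E) (s : Finset ι) (c : ι → ℝ) (hc : ∀ i ∈ s, 0 ≤ c i) :
    ∃ t ⊆ s, ∃ c' : ι → ℝ, (∀ i ∈ t, 0 < c' i) ∧ LinearIndepOn ℝ v (t : Set ι) ∧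
      ∑ i ∈ t, c' i • v i = ∑ i ∈ s, c i • v i := by
  classical
  induction s using Finset.strongInduction generalizing c with
  | H s ih =>
    have drop : ∀ c₁ : ι → ℝ, (∀ i ∈ s, 0 ≤ c₁ i) →
        ∑ i ∈ s, c₁ i • v i = ∑ i ∈ s, c i • v i → (∃ j ∈ s, c₁ j = 0) →
        ∃ t ⊆ s, ∃ c' : ι → ℝ, (∀ i ∈ t, 0 < c' i) ∧ LinearIndepOn ℝ v (t : Set ι) ∧
          ∑ i ∈ t, c' i • v i = ∑ i ∈ s, c i • v i := by
      rintro c₁ hc₁ hsum ⟨j, hj, hj0⟩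
      obtain ⟨t, ht, c', hpos, hli, heq⟩ := ih (s.erase j) (Finset.erase_ssubset hj) c₁
        fun i hi => hc₁ i (Finset.mem_of_mem_erase hi)
      refine ⟨t, ht.trans (Finset.erase_subset _ _), c', hpos, hli, ?_⟩
      rw [heq, ← hsum]
      exact Finset.sum_erase _ (by simp [hj0])
    by_cases hzero : ∃ j ∈ s, c j = 0
    · exact drop c hc rfl hzero
    have hpos : ∀ i ∈ s, 0 < c i := fun i hi =>
      (hc i hi).lt_of_ne fun h => hzero ⟨i, hi, h.symm⟩
    by_cases hli : LinearIndepOn ℝ v (s : Set ι)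
    · exact ⟨s, subset_rfl, c, hpos, hli, rfl⟩
    obtain ⟨g, hg, hgpos⟩ : ∃ g : ι → ℝ, ∑ i ∈ s, g i • v i = 0 ∧ ∃ i ∈ s, 0 < g i := by
      rw [not_linearIndepOn_finset_iff] at hli
      obtain ⟨g, hg, i, hi, hne⟩ := hli
      rcases hne.lt_or_gt with hlt | hgt
      · exact ⟨-g, by simp [hg], i, hi, by simpa using hlt⟩
      · exact ⟨g, hg, i, hi, hgt⟩
    obtain ⟨j, hj, hmin⟩ := (s.filter fun i => 0 < g i).exists_min_image (fun i => c i / g i)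
      (by obtain ⟨i, hi, h⟩ := hgpos; exact ⟨i, by simp [hi, h]⟩)
    rw [Finset.mem_filter] at hj
    refine drop (fun i => c i - c j / g j * g i) (fun i hi => ?_) ?_ ⟨j, hj.1, ?_⟩
    · rw [sub_nonneg]
      rcases le_or_gt (g i) 0 with h | h
      · exact (mul_nonpos_of_nonneg_of_nonpos (div_pos (hpos j hj.1) hj.2).le h).trans (hc i hi)
      · rw [← le_div_iff₀ h]
        exact hmin i (by simp [hi, h])
    · simp only [sub_smul, mul_smul, Finset.sum_sub_distrib, ← Finset.smul_sum, hg, smul_zero,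
        sub_zero]
    · rw [div_mul_cancel₀ _ hj.2.ne', sub_self]

/-- The cone generated by finitely many vectors of a Hausdorff topological vector space is
closed. -/
theorem isClosed_setOf_nonneg_sum_smul {ι E : Type*} [AddCommGroup E] [Module ℝ E]
    [TopologicalSpace E] [IsTopologicalAddGroup E] [ContinuousSMul ℝ E] [T2Space E]
    (v : ι → E) (s : Finset ι) :
    IsClosed {x | ∃ c : ι → ℝ, (∀ i ∈ s, 0 ≤ c i) ∧ ∑ i ∈ s, c i • v i = x} := by
  classical
  have hunion : {x | ∃ c : ι → ℝ, (∀ i ∈ s, 0 ≤ c i) ∧ ∑ i ∈ s, c i • v i = x} =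
      ⋃ t ∈ ({t ∈ s.powerset | LinearIndepOn ℝ v (t : Set ι)} : Finset (Finset ι)),
        Fintype.linearCombination ℝ (fun i : t => v i) '' Set.Ici 0 := by
    ext x
    simp only [Set.mem_ofPred_eq, Set.mem_iUnion, Finset.mem_filter, Finset.mem_powerset,
      exists_prop, Set.mem_image, Set.mem_Ici, Fintype.linearCombination_apply]
    constructor
    · rintro ⟨c, hc, rfl⟩
      obtain ⟨t, ht, c', hpos, hli, heq⟩ := exists_linearIndepOn_pos_sum_smul v s c hc
      refine ⟨t, ⟨ht, hli⟩, fun i => c' i, fun i => (hpos i i.2).le, ?_⟩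
      rw [← heq]
      exact Finset.sum_coe_sort t fun i => c' i • v i
    · rintro ⟨t, ⟨ht, -⟩, c, hc, rfl⟩
      refine ⟨fun i => if h : i ∈ t then c ⟨i, h⟩ else 0, fun i _ => ?_, ?_⟩
      · dsimp only
        split_ifs with h
        exacts [hc ⟨i, h⟩, le_rfl]
      · rw [← Finset.sum_subset ht fun i _ hi => by simp [hi], ← Finset.sum_coe_sort t]
        simp
  rw [hunion]
  refine isClosed_biUnion_finset fun t ht => ?_
  have hli : LinearIndependent ℝ fun i : t => v i := (Finset.mem_filter.1 ht).2
  refine (LinearMap.isClosedEmbedding_of_injective ?_).isClosedMap _ isClosed_Ici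
  rw [LinearMap.ker_eq_bot]
  exact hli.fintypeLinearCombination_injective

/-- **Farkas' lemma** for finitely many vectors. -/
theorem exists_nonneg_sum_smul_eq_of_forall_inner_nonneg {ι E : Type*} [NormedAddCommGroup E]
    [InnerProductSpace ℝ E] [CompleteSpace E] (v : ι → E) (s : Finset ι) (a : E)
    (h : ∀ d, (∀ i ∈ s, 0 ≤ ⟪v i, d⟫) → 0 ≤ ⟪a, d⟫) :
    ∃ c : ι → ℝ, (∀ i ∈ s, 0 ≤ c i) ∧ ∑ i ∈ s, c i • v i = a := by
  classical
  let K : ProperCone ℝ E :=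
    { carrier := {x | ∃ c : ι → ℝ, (∀ i ∈ s, 0 ≤ c i) ∧ ∑ i ∈ s, c i • v i = x}
      add_mem' := by
        rintro _ _ ⟨c, hc, rfl⟩ ⟨c', hc', rfl⟩
        exact ⟨c + c', fun i hi => add_nonneg (hc i hi) (hc' i hi), by
          simp [add_smul, Finset.sum_add_distrib]⟩
      zero_mem' := ⟨0, by simp⟩
      smul_mem' := by
        rintro r _ ⟨c, hc, rfl⟩
        exact ⟨fun i => r * c i, fun i hi => mul_nonneg r.2 (hc i hi), by
          simp only [mul_smul, Finset.smul_sum]; rfl⟩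
      isClosed' := isClosed_setOf_nonneg_sum_smul v s }
  by_contra hne
  obtain ⟨y, hy, hay⟩ := ProperCone.hyperplane_separation' K (x₀ := a) hne
  refine (h y fun i hi => hy _ ⟨Pi.single i 1, fun j _ => ?_, ?_⟩).not_gt hay
  · rcases eq_or_ne j i with rfl | hji <;> simp [*]
  · rw [Finset.sum_eq_single_of_mem i hi fun j _ hji => by simp [hji]]
    simp

/-- If `a` is bounded below on the polyhedron given by `s` by its value at the point `x₀`, it is
nonnegative on every direction pointing into the halfspaces of `s` active at `x₀`. -/
theorem inner_nonneg_of_forall_active {E : Type*} [NormedAddCommGroup E] [InnerProductSpace ℝ E]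
    (s : Finset (E × ℝ)) (a x₀ : E) (hx₀ : ∀ p ∈ s, p.2 ≤ ⟪p.1, x₀⟫)
    (hmin : ∀ x, (∀ p ∈ s, p.2 ≤ ⟪p.1, x⟫) → ⟪a, x₀⟫ ≤ ⟪a, x⟫) (d : E)
    (hd : ∀ p ∈ s, ⟪p.1, x₀⟫ = p.2 → 0 ≤ ⟪p.1, d⟫) : 0 ≤ ⟪a, d⟫ := by
  have hev : ∀ᶠ ε : ℝ in nhdsWithin 0 (Set.Ioi 0), ∀ p ∈ s, p.2 ≤ ⟪p.1, x₀ + ε • d⟫ := by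
    rw [Finset.eventually_all]
    intro p hp
    rcases (hx₀ p hp).eq_or_lt with heq | hlt
    · filter_upwards [self_mem_nhdsWithin] with ε hε
      rw [inner_add_right, inner_smul_right, ← heq]
      exact le_add_of_nonneg_right (mul_nonneg (le_of_lt hε) (hd p hp heq.symm))
    · have hcont : Continuous fun ε : ℝ => ⟪p.1, x₀ + ε • d⟫ := by fun_prop
      have hlim := hcont.tendsto 0
      simp only [zero_smul, add_zero] at hlim
      exact nhdsWithin_le_nhds ((hlim.eventually_const_lt hlt).mono fun _ => le_of_lt)
  obtain ⟨ε, hmem, hε⟩ := (hev.and self_mem_nhdsWithin).exists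
  have := hmin _ hmem
  rw [inner_add_right, inner_smul_right] at this
  exact nonneg_of_mul_nonneg_right (by linarith) hε

/-- A linearly independent family orthogonal to all differences of points of `A` has at most
`n - setDim A` members. -/
theorem card_le_sub_setDim {n : ℕ} {ι : Type*} {A : Set (EuclideanSpace ℝ (Fin n))}
    (hA : A.Nonempty) (v : ι → EuclideanSpace ℝ (Fin n)) (t : Finset ι)
    (hli : LinearIndepOn ℝ v (t : Set ι))
    (horth : ∀ i ∈ t, ∀ x ∈ A, ∀ y ∈ A, ⟪v i, x - y⟫ = 0) :
    (t.card : ℤ) ≤ (n : ℤ) - setDim A := by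
  rw [setDim, if_neg hA.ne_empty, direction_affineSpan]
  have hmem : ∀ i : t, v i ∈ (vectorSpan ℝ A)ᗮ := by
    intro i
    rw [Submodule.mem_orthogonal', vectorSpan_def]
    intro u hu
    induction hu using Submodule.span_induction with
    | mem u hu =>
      obtain ⟨x, hx, y, hy, rfl⟩ := hu
      exact horth i i.2 x hx y hy
    | zero => exact inner_zero_right _
    | add u w _ _ hu hw => rw [inner_add_right, hu, hw, add_zero]
    | smul r u _ hu => rw [inner_smul_right, hu, mul_zero]
  have hli' : LinearIndependent ℝ fun i : t => (⟨v i, hmem i⟩ : (vectorSpan ℝ A)ᗮ) :=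
    LinearIndependent.of_comp (vectorSpan ℝ A)ᗮ.subtype hli
  have hcard := hli'.fintype_card_le_finrank
  have hfin := (vectorSpan ℝ A).finrank_add_finrank_orthogonal
  rw [finrank_euclideanSpace_fin] at hfin
  rw [Fintype.card_coe] at hcard
  omega

/--
Let `𝒮` be a finite set of closed halfspaces of `ℝ^n` (each encoded by a pair `(a, b)` with
`a ≠ 0`, the halfspace being `{x : ⟪a, x⟫ ≥ b}`) whose intersection `P = Pol(𝒮)` has
dimension `n`, and let `H_F⁺ = {x : ⟪a, x⟫ ≥ b}` (with `a ≠ 0`) be a supporting halfspace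
of `P` (i.e. `P ⊆ H_F⁺`, the hyperplane `H_F` does not cut `P` and passes through `P`)
with touching set `F = H_F ∩ P`.  Then there exists `ℋ_F ⊆ 𝒮` with
`|ℋ_F| ≤ n − dim F` such that `H_F⁺` is a supporting halfspace of `Pol(ℋ_F)` and the
touching set `C = H_F ∩ Pol(ℋ_F)` satisfies `F ⊆ C`.
-/
theorem supporting_halfspace_from_few_halfspaces {n : ℕ}
    (𝒮 : Finset (EuclideanSpace ℝ (Fin n) × ℝ))
    (h𝒮 : ∀ p ∈ 𝒮, p.1 ≠ 0)
    (a : EuclideanSpace ℝ (Fin n)) (b : ℝ) (ha : a ≠ 0)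
    (hdim : setDim {x | ∀ p ∈ 𝒮, p.2 ≤ ⟪p.1, x⟫} = n)
    (hsubset : {x | ∀ p ∈ 𝒮, p.2 ≤ ⟪p.1, x⟫} ⊆ {x | b ≤ ⟪a, x⟫})
    (hnocut : ¬ ((∃ x ∈ {x | ∀ p ∈ 𝒮, p.2 ≤ ⟪p.1, x⟫}, b < ⟪a, x⟫) ∧
                 (∃ x ∈ {x | ∀ p ∈ 𝒮, p.2 ≤ ⟪p.1, x⟫}, ⟪a, x⟫ < b)))
    (htouch : ({x | ⟪a, x⟫ = b} ∩ {x | ∀ p ∈ 𝒮, p.2 ≤ ⟪p.1, x⟫}).Nonempty) :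
    ∃ ℋ ⊆ 𝒮,
      (ℋ.card : ℤ) ≤ (n : ℤ) -
          setDim ({x | ⟪a, x⟫ = b} ∩ {x | ∀ p ∈ 𝒮, p.2 ≤ ⟪p.1, x⟫}) ∧
      {x | ∀ p ∈ ℋ, p.2 ≤ ⟪p.1, x⟫} ⊆ {x | b ≤ ⟪a, x⟫} ∧
      ¬ ((∃ x ∈ {x | ∀ p ∈ ℋ, p.2 ≤ ⟪p.1, x⟫}, b < ⟪a, x⟫) ∧
         (∃ x ∈ {x | ∀ p ∈ ℋ, p.2 ≤ ⟪p.1, x⟫}, ⟪a, x⟫ < b)) ∧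
      ({x | ⟪a, x⟫ = b} ∩ {x | ∀ p ∈ ℋ, p.2 ≤ ⟪p.1, x⟫}).Nonempty ∧
      ({x | ⟪a, x⟫ = b} ∩ {x | ∀ p ∈ 𝒮, p.2 ≤ ⟪p.1, x⟫}) ⊆
        ({x | ⟪a, x⟫ = b} ∩ {x | ∀ p ∈ ℋ, p.2 ≤ ⟪p.1, x⟫}) := by
  classical
  obtain ⟨x₀, hx₀b, hx₀⟩ := id htouch
  simp only [Set.mem_ofPred_eq] at hx₀b hx₀
  obtain ⟨c₀, hc₀, hsum₀⟩ := exists_nonneg_sum_smul_eq_of_forall_inner_nonneg Prod.fst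
    (𝒮.filter fun p => ⟪p.1, x₀⟫ = p.2) a fun d hd =>
      inner_nonneg_of_forall_active 𝒮 a x₀ hx₀ (fun x hx => hx₀b.trans_le (hsubset hx)) d
        fun p hp hact => hd p (Finset.mem_filter.2 ⟨hp, hact⟩)
  obtain ⟨ℋ, hℋ, c, hc, hli, hsum⟩ := exists_linearIndepOn_pos_sum_smul Prod.fst _ c₀ hc₀
  rw [hsum₀] at hsum
  have hsub : ℋ ⊆ 𝒮 := hℋ.trans (Finset.filter_subset _ _)
  have hact : ∀ p ∈ ℋ, ⟪p.1, x₀⟫ = p.2 := fun p hp => (Finset.mem_filter.1 (hℋ hp)).2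
  have hinner : ∀ x, ⟪a, x⟫ = b + ∑ p ∈ ℋ, c p * (⟪p.1, x⟫ - p.2) := by
    intro x
    have hexp : ∀ y, ⟪a, y⟫ = ∑ p ∈ ℋ, c p * ⟪p.1, y⟫ := fun y => by
      rw [← hsum, sum_inner]
      simp [real_inner_smul_left]
    rw [← hx₀b, hexp x, hexp x₀, ← Finset.sum_add_distrib]
    refine Finset.sum_congr rfl fun p hp => ?_
    rw [hact p hp]
    ring
  have hge : {x | ∀ p ∈ ℋ, p.2 ≤ ⟪p.1, x⟫} ⊆ {x | b ≤ ⟪a, x⟫} := fun x hx => by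
    rw [Set.mem_ofPred_eq, hinner x]
    exact le_add_of_nonneg_right
      (Finset.sum_nonneg fun p hp => mul_nonneg (hc p hp).le (sub_nonneg.2 (hx p hp)))
  have hactive : ∀ x ∈ {x | ⟪a, x⟫ = b} ∩ {x | ∀ p ∈ 𝒮, p.2 ≤ ⟪p.1, x⟫},
      ∀ p ∈ ℋ, ⟪p.1, x⟫ = p.2 := by
    rintro x ⟨hxb, hx⟩ p hp
    have hzero : ∑ p ∈ ℋ, c p * (⟪p.1, x⟫ - p.2) = 0 := by
      have := hinner x
      rw [Set.mem_ofPred_eq] at hxb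
      linarith
    have := (Finset.sum_eq_zero_iff_of_nonneg fun p hp =>
      mul_nonneg (hc p hp).le (sub_nonneg.2 (hx p (hsub hp)))).1 hzero p hp
    exact sub_eq_zero.1 ((mul_eq_zero.1 this).resolve_left (hc p hp).ne')
  have hface : ({x | ⟪a, x⟫ = b} ∩ {x | ∀ p ∈ 𝒮, p.2 ≤ ⟪p.1, x⟫}) ⊆
      ({x | ⟪a, x⟫ = b} ∩ {x | ∀ p ∈ ℋ, p.2 ≤ ⟪p.1, x⟫}) :=
    fun x hx => ⟨hx.1, fun p hp => hx.2 p (hsub hp)⟩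
  refine ⟨ℋ, hsub, ?_, hge, ?_, htouch.mono hface, hface⟩
  · refine card_le_sub_setDim htouch Prod.fst ℋ hli fun p hp x hx y hy => ?_
    rw [inner_sub_right, hactive x hx p hp, hactive y hy p hp, sub_self]
  · rintro ⟨-, x, hx, hlt⟩
    exact (hge hx).not_gt hlt
end

section
/- Let (N, v) be a coalitional game with transferable utility, let x ∈ ℝ^N, let i ≠ j be players, and let S be a coalition containing i but not j. Define W(i,j,S) = { y ∈ ℝ^S : y(S) = v(S), y_k > x_k for each k ∈ S, and v(T) < y(T ∩ S) + x(T \ S) for every coalition T containing j but not i }. If W(i,j,S) = ∅, then there exist m ≤ |S| + 1 coalitions T₁, …, T_m, each containing j but not i, such that already { y ∈ ℝ^S : y(S) = v(S), y_k > x_k for each k ∈ S, and v(T_ℓ) < y(T_ℓ ∩ S) + x(T_ℓ \ S) for each 1 ≤ ℓ ≤ m } = ∅. -/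
/--
**Succinct witnesses for emptiness of `W(i,j,S)` (Helly's theorem application).**
If the set `W(i,j,S)` of vectors `y ∈ ℝ^S` with `y(S) = v(S)`, `y k > x k` on `S`, and
`v(T) < y(T ∩ S) + x(T \ S)` for every coalition `T` containing `j` but not `i` is empty,
then there are `m ≤ |S| + 1` such coalitions `T₁, …, T_m` witnessing the emptiness.
-/
theorem W_emptiness_certificate {N : Type*} [Fintype N] [DecidableEq N] [Nonempty N]
    (v : Finset N → ℝ) (x : N → ℝ)
    (i j : N) (hij : i ≠ j) (S : Finset N) (hiS : i ∈ S) (hjS : j ∉ S)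
    (hW : ¬ ∃ y : N → ℝ,
        (∑ k ∈ S, y k) = v S ∧
        (∀ k ∈ S, y k > x k) ∧
        ∀ T : Finset N, j ∈ T → i ∉ T →
          v T < (∑ k ∈ T ∩ S, y k) + ∑ k ∈ T \ S, x k) :
    ∃ 𝒯 : Finset (Finset N), 𝒯.card ≤ S.card + 1 ∧ (∀ T ∈ 𝒯, j ∈ T ∧ i ∉ T) ∧
      ¬ ∃ y : N → ℝ,
        (∑ k ∈ S, y k) = v S ∧
        (∀ k ∈ S, y k > x k) ∧
        ∀ T ∈ 𝒯, v T < (∑ k ∈ T ∩ S, y k) + ∑ k ∈ T \ S, x k := by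
  classical
  by_contra! hcon
  let C : Finset N → Set (N → ℝ) := fun T =>
    {y | (∑ k ∈ S, y k) = v S ∧ (∀ k ∈ S, y k > x k) ∧
      v T < (∑ k ∈ T ∩ S, y k) + ∑ k ∈ T \ S, x k}
  let extend : (S → ℝ) →ₗ[ℝ] (N → ℝ) := Function.ExtendByZero.linearMap ℝ Subtype.val
  have extend_restrict (y : N → ℝ) (k : N) (hk : k ∈ S) :
      extend (fun l => y l) k = y k :=
    Subtype.val_injective.extend_apply (fun l : S => y l) 0 ⟨k, hk⟩
  have hconvex (T : Finset N) : Convex ℝ (C T) := by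
    have hsum (U : Finset N) : IsLinearMap ℝ fun y : N → ℝ => ∑ k ∈ U, y k :=
      ⟨fun y z => by simp [Finset.sum_add_distrib], fun c y => by simp [Finset.mul_sum]⟩
    have hC : C T = {y | (∑ k ∈ S, y k) = v S} ∩ ((⋂ k ∈ S, {y | x k < y k}) ∩
        {y | v T - ∑ k ∈ T \ S, x k < ∑ k ∈ T ∩ S, y k}) := by
      ext y
      simp [C, sub_lt_iff_lt_add]
    rw [hC]
    exact (convex_hyperplane (hsum S) _).inter
      ((convex_iInter₂ fun k _ =>
        convex_halfSpace_gt ⟨fun _ _ => rfl, fun _ _ => rfl⟩ _).inter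
        (convex_halfSpace_gt (hsum (T ∩ S)) _))
  let A : Finset (Finset N) := {T | j ∈ T ∧ i ∉ T}
  obtain ⟨y, hy⟩ : (⋂ T ∈ A, extend ⁻¹' C T).Nonempty := by
    refine Convex.helly_theorem' (𝕜 := ℝ)
      (fun T _ => (hconvex T).linear_preimage extend) fun I hI hcard => ?_
    rw [Module.finrank_fintype_fun_eq_card, Fintype.card_coe] at hcard
    obtain ⟨z, hzS, hzx, hzv⟩ := hcon I hcard fun T hT => by simpa [A] using hI hT
    refine ⟨fun k => z k, Set.mem_iInter₂.2 fun T hT => ⟨?_, fun k hk => ?_, ?_⟩⟩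
    · rw [← hzS]
      exact Finset.sum_congr rfl (extend_restrict z)
    · rw [extend_restrict z k hk]
      exact hzx k hk
    · rw [Finset.sum_congr rfl fun k hk => extend_restrict z k (Finset.mem_inter.1 hk).2]
      exact hzv T hT
  have hyC (T : Finset N) (hjT : j ∈ T) (hiT : i ∉ T) : extend y ∈ C T :=
    Set.mem_iInter₂.1 hy T (by simp [A, hjT, hiT])
  have hbase := hyC {j} (by simp) (by simpa using hij)
  exact hW ⟨extend y, hbase.1, hbase.2.1, fun T hjT hiT => (hyC T hjT hiT).2.2⟩
end

section
/- Let φ = c₁ ∧ … ∧ c_m be a 3CNF formula over variables α₁, …, α_n in which some clause contains at least two literals, and let K(φ) = ((N_K, E_K), w) be the graph game associated with φ. Let D = max over all coalitions S ⊆ N_K with {chall, sat} ⊄ S of v(S), where v(S) = Σ_{e∈E_K, e⊆S} w(e). Then: (A) w({chall, sat}) ≥ D + 1; and (B) D + w(e) < 0 for each penalty edge e ∈ E_K. -/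
set_option synthInstance.maxSize 1000
set_option maxHeartbeats 1000000

/-!
The graph game `K(φ)` associated with a 3CNF formula `φ = c₁ ∧ … ∧ c_m` over variables
`α₁, …, α_n`.  A literal is a pair `(i, b) : Fin n × Bool` (`b = true` for the positive
literal `α_{i+1}`, `b = false` for `¬α_{i+1}`; we use `0`-based indices, so the paper's
variable `α_i` is index `i - 1` and its paper weight `2^i` becomes `2^(i+1)` here).
A clause is the finset of its literals, so `φ` is given by `c : Fin m → Finset (Fin n × Bool)`.

Players: a variable player for each variable, a clause player for each clause, a literal
player for each occurrence of a literal in a clause, and the special players `chall`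
(encoded by `false`) and `sat` (encoded by `true`).
-/

/-- Literal occurrences: a literal together with a clause it occurs in. -/
abbrev KLit (n m : ℕ) (c : Fin m → Finset (Fin n × Bool)) :=
  {p : (Fin n × Bool) × Fin m // p.1 ∈ c p.2}

/-- The players of the graph game `K(φ)`. -/
abbrev KP (n m : ℕ) (c : Fin m → Finset (Fin n × Bool)) :=
  Fin n ⊕ (Fin m ⊕ (KLit n m c ⊕ Bool))

variable {n m : ℕ} (c : Fin m → Finset (Fin n × Bool))

/-- The variable player `α_i`. -/
def KPvar (i : Fin n) : KP n m c := Sum.inl i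
/-- The clause player `c_j`. -/
def KPcl (j : Fin m) : KP n m c := Sum.inr (Sum.inl j)
/-- The literal player `ℓ_{i,j}`. -/
def KPlit (l : KLit n m c) : KP n m c := Sum.inr (Sum.inr (Sum.inl l))
/-- The player `chall`. -/
def KPchall : KP n m c := Sum.inr (Sum.inr (Sum.inr false))
/-- The player `sat`. -/
def KPsat : KP n m c := Sum.inr (Sum.inr (Sum.inr true))

/-- The (symmetric) edge-weight function of `K(φ)`, excluding the normalizer edge
`{chall, sat}`; `Kw0 c u v = 0` when `{u, v}` is not an edge.
Positive edges: `{c_j, ℓ_{i,j}}` of weight `2^(n+3)`; `{chall, α_i}` of weight `2^(i+1)`;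
`{sat, α_i}` of weight `2^(i+1)` plus an extra `2^0` for the first variable.
Penalty edges, of weight `-2^(m+n+7)`: pairs of distinct literal occurrences in the same
clause, opposite occurrences of the same variable, and `{α_i, ¬α_{i,j}}` for each negative
occurrence of a variable. -/
noncomputable def Kw0 : KP n m c → KP n m c → ℝ := fun u v =>
  match u, v with
  | Sum.inr (Sum.inl j), Sum.inr (Sum.inr (Sum.inl l)) =>
      if l.1.2 = j then (2:ℝ)^(n+3) else 0
  | Sum.inr (Sum.inr (Sum.inl l)), Sum.inr (Sum.inl j) =>
      if l.1.2 = j then (2:ℝ)^(n+3) else 0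
  | Sum.inl i, Sum.inr (Sum.inr (Sum.inr b)) =>
      (2:ℝ)^((i:ℕ)+1) + (if b = true ∧ (i:ℕ) = 0 then 1 else 0)
  | Sum.inr (Sum.inr (Sum.inr b)), Sum.inl i =>
      (2:ℝ)^((i:ℕ)+1) + (if b = true ∧ (i:ℕ) = 0 then 1 else 0)
  | Sum.inr (Sum.inr (Sum.inl l)), Sum.inr (Sum.inr (Sum.inl l')) =>
      if (l.1.2 = l'.1.2 ∧ l.1.1 ≠ l'.1.1) ∨ (l.1.1.1 = l'.1.1.1 ∧ l.1.1.2 ≠ l'.1.1.2)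
      then -((2:ℝ)^(m+n+7)) else 0
  | Sum.inl i, Sum.inr (Sum.inr (Sum.inl l)) =>
      if l.1.1 = (i, false) then -((2:ℝ)^(m+n+7)) else 0
  | Sum.inr (Sum.inr (Sum.inl l)), Sum.inl i =>
      if l.1.1 = (i, false) then -((2:ℝ)^(m+n+7)) else 0
  | _, _ => 0

/-- The weight of the normalizer edge `{chall, sat}`:
`1` minus the sum of the weights of all other edges. -/
noncomputable def Kwnorm : ℝ := 1 - (∑ u : KP n m c, ∑ v : KP n m c, Kw0 c u v) / 2

/-- The full (symmetric) edge-weight function of `K(φ)`. -/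
noncomputable def Kw (u v : KP n m c) : ℝ :=
  Kw0 c u v +
    (if (u = KPchall c ∧ v = KPsat c) ∨ (u = KPsat c ∧ v = KPchall c) then Kwnorm c else 0)

/-- The worth of a coalition `S` in the graph game `K(φ)`: the sum of the weights of all
edges contained in `S` (written via the symmetric weight function). -/
noncomputable def Kworth (S : Finset (KP n m c)) : ℝ := (∑ u ∈ S, ∑ v ∈ S, Kw c u v) / 2

/-- The payoff vector assigning `1` to the player `sat` and `0` to every other player. -/
noncomputable def Kx : KP n m c → ℝ := fun p => if p = KPsat c then 1 else 0

/-- `I_{i,j}`: the coalitions containing `i` but not `j`. -/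
def KIset (i j : KP n m c) : Finset (Finset (KP n m c)) :=
  Finset.univ.filter (fun S => i ∈ S ∧ j ∉ S)

/-- The surplus `s_{i,j}(x) = max_{S ∈ I_{i,j}} (v(S) - x(S))`.
(For `i ≠ j` the singleton `{i}` belongs to `I_{i,j}`, so inserting it does not change
the maximum; it merely makes the maximum well defined for all arguments.) -/
noncomputable def Ksurplus (i j : KP n m c) (x : KP n m c → ℝ) : ℝ :=
  (insert {i} (KIset c i j)).sup' (Finset.insert_nonempty _ _)
    (fun S => Kworth c S - ∑ k ∈ S, x k)

/-- `x` is an imputation: efficient and individually rational. -/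
def KIsImputation (x : KP n m c → ℝ) : Prop :=
  (∑ p, x p) = Kworth c Finset.univ ∧ ∀ p, x p ≥ Kworth c {p}

/-- Membership in the kernel of the game `K(φ)`. -/
def KInKernel (x : KP n m c → ℝ) : Prop :=
  KIsImputation c x ∧
    ∀ i j : KP n m c, i ≠ j → Ksurplus c i j x > Ksurplus c j i x → x j = Kworth c {j}

/-- `σ` is a satisfying assignment for `φ`. -/
def KSat (σ : Fin n → Bool) : Prop := ∀ j : Fin m, ∃ l ∈ c j, σ l.1 = l.2

instance : DecidablePred (KSat c) := fun σ => by unfold KSat; infer_instance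

/-- The value `∑_{α_i : σ(α_i) = true} 2^i` of an assignment (with `0`-based indices,
the paper's `2^i` is `2^(i+1)` here). -/
noncomputable def Kval (σ : Fin n → Bool) : ℝ :=
  ∑ i : Fin n, if σ i then (2:ℝ)^((i:ℕ)+1) else 0

/-- `D`: the maximum worth over all coalitions not containing both `chall` and `sat`. -/
noncomputable def KD : ℝ :=
  ((Finset.univ : Finset (Finset (KP n m c))).filter
      (fun S => ¬ ({KPchall c, KPsat c} ⊆ S))).sup'
    ⟨∅, by simp⟩ (Kworth c)

/-- One orientation of the penalty-edge relation of `K(φ)`. -/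
def KPenaltyHalf : KP n m c → KP n m c → Prop := fun u v =>
  (∃ l l' : KLit n m c, u = KPlit c l ∧ v = KPlit c l' ∧
      ((l.1.2 = l'.1.2 ∧ l.1.1 ≠ l'.1.1) ∨ (l.1.1.1 = l'.1.1.1 ∧ l.1.1.2 ≠ l'.1.1.2))) ∨
  (∃ (i : Fin n) (l : KLit n m c), u = KPvar c i ∧ v = KPlit c l ∧ l.1.1 = (i, false))

/-- `{u, v}` is a penalty edge of `K(φ)`. -/
def KPenalty (u v : KP n m c) : Prop := KPenaltyHalf c u v ∨ KPenaltyHalf c v u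

/-- The edge weights of `K(φ)` with the penalty and normalizer edges removed. -/
noncomputable def KPosWeight : KP n m c → KP n m c → ℝ := fun u v =>
  match u, v with
  | Sum.inr (Sum.inl j), Sum.inr (Sum.inr (Sum.inl l)) =>
      if l.1.2 = j then (2:ℝ)^(n+3) else 0
  | Sum.inr (Sum.inr (Sum.inl l)), Sum.inr (Sum.inl j) =>
      if l.1.2 = j then (2:ℝ)^(n+3) else 0
  | Sum.inl i, Sum.inr (Sum.inr (Sum.inr b)) =>
      (2:ℝ)^((i:ℕ)+1) + (if b = true ∧ (i:ℕ) = 0 then 1 else 0)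
  | Sum.inr (Sum.inr (Sum.inr b)), Sum.inl i =>
      (2:ℝ)^((i:ℕ)+1) + (if b = true ∧ (i:ℕ) = 0 then 1 else 0)
  | _, _ => 0

lemma KPosWeight_nonneg (u v : KP n m c) : 0 ≤ KPosWeight c u v := by
  rcases u with i | j | l | b <;> rcases v with i' | j' | l' | b' <;>
    simp only [KPosWeight] <;> first | exact le_rfl | positivity

lemma Kw0_le_KPosWeight (u v : KP n m c) : Kw0 c u v ≤ KPosWeight c u v := by
  rcases u with i | j | l | b <;> rcases v with i' | j' | l' | b' <;>
    simp only [KPosWeight, Kw0] <;>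
    first | exact le_rfl | (split_ifs <;> simp)

lemma card_KLit_le (h3 : ∀ j, (c j).card ≤ 3) : Fintype.card (KLit n m c) ≤ 3 * m := by
  let e : KLit n m c ≃ Σ j : Fin m, {x // x ∈ c j} :=
    { toFun := fun l => ⟨l.1.2, l.1.1, l.2⟩
      invFun := fun s => ⟨(s.2.1, s.1), s.2.2⟩
      left_inv := fun _ => rfl
      right_inv := fun _ => rfl }
  rw [Fintype.card_congr e, Fintype.card_sigma]
  calc ∑ j, Fintype.card {x // x ∈ c j} ≤ ∑ _j : Fin m, 3 :=
        Finset.sum_le_sum fun j _ => by simpa using h3 j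
    _ = 3 * m := by simp [mul_comm]

lemma sum_variable_weights_le (n : ℕ) :
    ∑ i : Fin n, ((2:ℝ)^((i:ℕ)+1) + (2:ℝ)^((i:ℕ)+1) + (if (i:ℕ) = 0 then 1 else 0))
      ≤ 4 * 2^n := by
  rw [Fin.sum_univ_eq_sum_range
    (fun i => (2:ℝ)^(i+1) + (2:ℝ)^(i+1) + (if i = 0 then 1 else 0)) n]
  suffices h : ∑ i ∈ Finset.range n,
      ((2:ℝ)^(i+1) + (2:ℝ)^(i+1) + (if i = 0 then 1 else 0)) ≤ 4 * 2^n - 3 by linarith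
  induction n with
  | zero => norm_num
  | succ k ih =>
    rw [Finset.sum_range_succ]
    rcases k with _ | k
    · norm_num
    · simp only [pow_succ] at ih ⊢
      simp only [Nat.add_eq_zero_iff, one_ne_zero, and_false, if_false]
      linarith

lemma sum_KPosWeight_le (h3 : ∀ j, (c j).card ≤ 3) :
    (∑ u : KP n m c, ∑ v : KP n m c, KPosWeight c u v) / 2 ≤ (24 * m + 4) * 2^n := by
  have hvar := sum_variable_weights_le n
  have hcard : (Fintype.card (KLit n m c) : ℝ) ≤ 3 * m := by exact_mod_cast card_KLit_le c h3
  have hlit : (Fintype.card (KLit n m c) : ℝ) * 2^(n+3) ≤ 24 * m * 2^n := by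
    have : (0:ℝ) < 2^n := by positivity
    rw [pow_add]; nlinarith
  have hsum : ∑ u : KP n m c, ∑ v : KP n m c, KPosWeight c u v =
      2 * (Fintype.card (KLit n m c) * 2^(n+3)) +
      2 * ∑ i : Fin n, ((2:ℝ)^((i:ℕ)+1) + (2:ℝ)^((i:ℕ)+1) + (if (i:ℕ) = 0 then 1 else 0)) := by
    have hcl : ∑ j : Fin m, ∑ l : KLit n m c, (if l.1.2 = j then (2:ℝ)^(n+3) else 0) =
        Fintype.card (KLit n m c) * 2^(n+3) := by
      rw [Finset.sum_comm]
      simp only [Finset.sum_ite_eq, Finset.mem_univ, if_true, Finset.sum_const,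
        Finset.card_univ, nsmul_eq_mul]
    have hlc : ∑ l : KLit n m c, ∑ j : Fin m, (if l.1.2 = j then (2:ℝ)^(n+3) else 0) =
        Fintype.card (KLit n m c) * 2^(n+3) := by rw [Finset.sum_comm, hcl]
    simp only [Fintype.sum_sum_type, KPosWeight, Finset.sum_const_zero, add_zero, zero_add,
      Fintype.sum_bool, hcl, hlc, Finset.sum_add_distrib, true_and, Bool.false_eq_true,
      false_and, if_false]
    ring
  linarith

lemma two_mul_bound_le (n m : ℕ) : 2 * ((24 * (m:ℝ) + 4) * 2^n) ≤ 2^(m+n+7) := by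
  have hm : (m:ℝ) + 1 ≤ 2^m := by exact_mod_cast Nat.lt_two_pow_self
  have hn : (0:ℝ) < 2^n := by positivity
  have hm0 : (0:ℝ) ≤ m := by positivity
  rw [show (2:ℝ)^(m+n+7) = 128 * 2^m * 2^n by ring]
  nlinarith [mul_le_mul_of_nonneg_right hm hn.le, mul_nonneg hm0 hn.le]

lemma Kworth_le_of_not_subset (h3 : ∀ j, (c j).card ≤ 3) (S : Finset (KP n m c))
    (hS : ¬ ({KPchall c, KPsat c} ⊆ S)) : Kworth c S ≤ (24 * m + 4) * 2^n := by
  have hw : ∀ u ∈ S, ∀ v ∈ S, Kw c u v ≤ KPosWeight c u v := by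
    intro u hu v hv
    rw [Kw, if_neg, add_zero]
    · exact Kw0_le_KPosWeight c u v
    · rintro (⟨rfl, rfl⟩ | ⟨rfl, rfl⟩) <;>
        exact hS (by simp [Finset.insert_subset_iff, hu, hv])
  have h : ∑ u ∈ S, ∑ v ∈ S, Kw c u v ≤ ∑ u : KP n m c, ∑ v : KP n m c, KPosWeight c u v :=
    calc ∑ u ∈ S, ∑ v ∈ S, Kw c u v ≤ ∑ u ∈ S, ∑ v ∈ S, KPosWeight c u v :=
          Finset.sum_le_sum fun u hu => Finset.sum_le_sum fun v hv => hw u hu v hv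
      _ ≤ ∑ u ∈ S, ∑ v : KP n m c, KPosWeight c u v :=
          Finset.sum_le_sum fun u _ => Finset.sum_le_sum_of_subset_of_nonneg
            (Finset.subset_univ S) fun v _ _ => KPosWeight_nonneg c u v
      _ ≤ _ := Finset.sum_le_sum_of_subset_of_nonneg (Finset.subset_univ S)
            fun u _ _ => Finset.sum_nonneg fun v _ => KPosWeight_nonneg c u v
  have := sum_KPosWeight_le c h3
  rw [Kworth]
  linarith

lemma KD_le (h3 : ∀ j, (c j).card ≤ 3) : KD c ≤ (24 * m + 4) * 2^n :=
  Finset.sup'_le _ _ fun S hS => Kworth_le_of_not_subset c h3 S (Finset.mem_filter.mp hS).2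

lemma sum_Kw0_le (h2 : ∃ j, 2 ≤ (c j).card) :
    (∑ u : KP n m c, ∑ v : KP n m c, Kw0 c u v) / 2 ≤
      (∑ u : KP n m c, ∑ v : KP n m c, KPosWeight c u v) / 2 - 2^(m+n+7) := by
  obtain ⟨j, hj⟩ := h2
  obtain ⟨a, ha, b, hb, hab⟩ := Finset.one_lt_card.mp hj
  let A : KP n m c := KPlit c ⟨(a, j), ha⟩
  let B : KP n m c := KPlit c ⟨(b, j), hb⟩
  have hAB : A ≠ B := by
    intro h
    simp only [A, B, KPlit, Sum.inr.injEq, Sum.inl.injEq, Subtype.mk.injEq,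
      Prod.mk.injEq, and_true] at h
    exact hab h
  have hle : ∑ p ∈ ({(A, B), (B, A)} : Finset (KP n m c × KP n m c)),
        (KPosWeight c p.1 p.2 - Kw0 c p.1 p.2) ≤
      ∑ p : KP n m c × KP n m c, (KPosWeight c p.1 p.2 - Kw0 c p.1 p.2) :=
    Finset.sum_le_sum_of_subset_of_nonneg (Finset.subset_univ _)
      fun p _ _ => sub_nonneg.mpr (Kw0_le_KPosWeight c p.1 p.2)
  rw [Finset.sum_pair (by simp [hAB]), Fintype.sum_prod_type] at hle
  simp only [Finset.sum_sub_distrib] at hle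
  have h1 : KPosWeight c A B - Kw0 c A B = 2^(m+n+7) := by
    simp [A, B, KPlit, KPosWeight, Kw0, hab]
  have h2 : KPosWeight c B A - Kw0 c B A = 2^(m+n+7) := by
    simp [A, B, KPlit, KPosWeight, Kw0, hab.symm]
  linarith

lemma Kw_of_penaltyHalf {u v : KP n m c} (h : KPenaltyHalf c u v) :
    Kw c u v = -2^(m+n+7) ∧ Kw c v u = -2^(m+n+7) := by
  rcases h with ⟨l, l', rfl, rfl, h⟩ | ⟨i, l, rfl, rfl, h⟩
  · have h' : (l'.1.2 = l.1.2 ∧ l'.1.1 ≠ l.1.1) ∨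
        (l'.1.1.1 = l.1.1.1 ∧ l'.1.1.2 ≠ l.1.1.2) :=
      h.imp (fun h => ⟨h.1.symm, h.2.symm⟩) fun h => ⟨h.1.symm, h.2.symm⟩
    constructor
    · simp only [Kw, Kw0, KPlit, KPchall, KPsat, if_pos h]; simp
    · simp only [Kw, Kw0, KPlit, KPchall, KPsat, if_pos h']; simp
  · constructor <;> simp [Kw, Kw0, KPlit, KPvar, KPchall, KPsat, h]

/--
**Lemma (properties of `K(φ)`).**
Let `φ = c₁ ∧ … ∧ c_m` be a 3CNF formula over variables `α₁, …, α_n` in which some clause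
contains at least two literals, and let `K(φ)` be the associated graph game.
Let `D` be the maximum worth over all coalitions not containing both `chall` and `sat`.
Then (A) `w({chall, sat}) ≥ D + 1`, and (B) `D + w(e) < 0` for each penalty edge `e`.
-/
theorem K_game_weight_properties (n m : ℕ) (c : Fin m → Finset (Fin n × Bool))
    (h3 : ∀ j, (c j).card ≤ 3) (h2 : ∃ j, 2 ≤ (c j).card) :
    Kw c (KPchall c) (KPsat c) ≥ KD c + 1 ∧
    (∀ u v : KP n m c, KPenalty c u v → KD c + Kw c u v < 0) := by
  have hD := KD_le c h3
  have hP := two_mul_bound_le n m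
  refine ⟨?_, fun u v huv => ?_⟩
  · have hw : Kw c (KPchall c) (KPsat c) = Kwnorm c := by simp [Kw, Kw0, KPchall, KPsat]
    have hneg := sum_Kw0_le c h2
    have hpos := sum_KPosWeight_le c h3
    rw [hw, Kwnorm]
    linarith
  · have hw : Kw c u v = -2^(m+n+7) :=
      huv.elim (fun h => (Kw_of_penaltyHalf c h).1) fun h => (Kw_of_penaltyHalf c h).2
    have hB : 0 < (24 * (m:ℝ) + 4) * 2^n := by positivity
    rw [hw]
    linarith
end

section
/- Let φ be a satisfiable 3CNF formula over variables α₁, …, α_n with clauses c₁, …, c_m in which some clause contains at least two literals, let K(φ) be the associated graph game, and let x be the imputation assigning payoff 1 to player sat and 0 to every other player. Then x belongs to the kernel of K(φ) if and only if the variable α₁ evaluates to true in the lexicographically maximum satisfying assignment of φ, i.e. in the satisfying assignment σ maximizing Σ_{α_i : σ(α_i)=true} 2^i. -/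
set_option synthInstance.maxSize 1000
set_option maxHeartbeats 1000000

variable {n m : ℕ} (c : Fin m → Finset (Fin n × Bool))

/-- The total weight of the clause–literal edges inside `S`. -/
noncomputable def Kclause (S : Finset (KP n m c)) : ℝ :=
  ∑ j : Fin m, ∑ l : KLit n m c,
    if KPcl c j ∈ S ∧ KPlit c l ∈ S ∧ l.1.2 = j then (2:ℝ)^(n+3) else 0

/-- The weight of the edge between a variable player and `sat` (`b = true`) or `chall`. -/
def Kcoef (b : Bool) (i : Fin n) : ℝ :=
  (2:ℝ)^((i:ℕ)+1) + (if b = true ∧ (i:ℕ) = 0 then 1 else 0)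

/-- The total weight inside `S` of the edges between variable players and `chall`, `sat`. -/
noncomputable def Kvars (S : Finset (KP n m c)) : ℝ :=
  ∑ i : Fin n, ∑ b : Bool,
    if KPvar c i ∈ S ∧ (Sum.inr (Sum.inr (Sum.inr b)) : KP n m c) ∈ S then Kcoef b i else 0

/-- Two literal occurrences are joined by a penalty edge. -/
def KConflict (l l' : KLit n m c) : Prop :=
  (l.1.2 = l'.1.2 ∧ l.1.1 ≠ l'.1.1) ∨ (l.1.1.1 = l'.1.1.1 ∧ l.1.1.2 ≠ l'.1.1.2)

open Classical in
/-- The absolute value of the total weight of the penalty edges inside `S`. -/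
noncomputable def Kpen (S : Finset (KP n m c)) : ℝ :=
  (∑ l : KLit n m c, ∑ l' : KLit n m c,
    if KPlit c l ∈ S ∧ KPlit c l' ∈ S ∧ KConflict c l l' then (2:ℝ)^(m+n+7) else 0) / 2 +
  ∑ i : Fin n, ∑ l : KLit n m c,
    if KPvar c i ∈ S ∧ KPlit c l ∈ S ∧ l.1.1 = (i, false) then (2:ℝ)^(m+n+7) else 0

/-- The value of an assignment as seen by `chall` (`b = false`) or `sat` (`b = true`). -/
noncomputable def Kvalue (b : Bool) (σ : Fin n → Bool) : ℝ :=
  ∑ i : Fin n, if σ i then Kcoef b i else 0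

theorem Kw0_half_sum (S : Finset (KP n m c)) :
    (∑ u ∈ S, ∑ v ∈ S, Kw0 c u v) / 2 = Kclause c S + Kvars c S - Kpen c S := by
  classical
  have hS : ∑ u ∈ S, ∑ v ∈ S, Kw0 c u v =
      ∑ u, ∑ v, if u ∈ S ∧ v ∈ S then Kw0 c u v else 0 := by
    simp only [ite_and, Finset.sum_ite_irrel, Finset.sum_const_zero, Finset.sum_ite_mem,
      Finset.univ_inter]
  rw [hS]
  simp only [Fintype.sum_sum_type, Kw0, ite_self, Finset.sum_const_zero, add_zero, zero_add,
    Finset.sum_add_distrib]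
  unfold Kpen
  set A := ∑ l : KLit n m c, ∑ l' : KLit n m c,
    if KPlit c l ∈ S ∧ KPlit c l' ∈ S ∧ KConflict c l l' then (2:ℝ)^(m+n+7) else 0 with hA
  set B := ∑ i : Fin n, ∑ l : KLit n m c,
    if KPvar c i ∈ S ∧ KPlit c l ∈ S ∧ l.1.1 = (i, false) then (2:ℝ)^(m+n+7) else 0 with hB
  trans ((-B + Kvars c S) + (Kclause c S + ((-B + (Kclause c S + -A)) + Kvars c S))) / 2
  · refine congrArg (· / 2) (congrArg₂ (· + ·) (congrArg₂ (· + ·) ?_ ?_) (congrArg₂ (· + ·) ?_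
      (congrArg₂ (· + ·) (congrArg₂ (· + ·) ?_ (congrArg₂ (· + ·) ?_ ?_)) ?_)))
    · rw [Finset.sum_comm, hB]
      simp only [← Finset.sum_neg_distrib, KPvar, KPlit]
      refine Finset.sum_congr rfl fun i _ => Finset.sum_congr rfl fun l _ => ?_
      by_cases h1 : (Sum.inr (Sum.inr (Sum.inl l)) : KP n m c) ∈ S <;>
        by_cases h2 : (Sum.inl i : KP n m c) ∈ S <;> simp [h1, h2]
      split_ifs <;> simp
    · rw [Finset.sum_comm, Kvars]
      refine Finset.sum_congr rfl fun i _ => Finset.sum_congr rfl fun b _ => ?_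
      by_cases h1 : (Sum.inl i : KP n m c) ∈ S <;>
        by_cases h2 : (Sum.inr (Sum.inr (Sum.inr b)) : KP n m c) ∈ S <;>
        simp [h1, h2, KPvar, Kcoef]
    · rw [Finset.sum_comm, Kclause]
      refine Finset.sum_congr rfl fun j _ => Finset.sum_congr rfl fun l _ => ?_
      simp only [KPcl, KPlit]
      by_cases h1 : (Sum.inr (Sum.inr (Sum.inl l)) : KP n m c) ∈ S <;>
        by_cases h2 : (Sum.inr (Sum.inl j) : KP n m c) ∈ S <;> simp [h1, h2]
    · rw [hB]
      simp only [← Finset.sum_neg_distrib, KPvar, KPlit]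
      refine Finset.sum_congr rfl fun i _ => Finset.sum_congr rfl fun l _ => ?_
      by_cases h1 : (Sum.inr (Sum.inr (Sum.inl l)) : KP n m c) ∈ S <;>
        by_cases h2 : (Sum.inl i : KP n m c) ∈ S <;> simp [h1, h2]
      split_ifs <;> simp
    · rw [Kclause]
      refine Finset.sum_congr rfl fun j _ => Finset.sum_congr rfl fun l _ => ?_
      simp only [KPcl, KPlit]
      by_cases h1 : (Sum.inr (Sum.inr (Sum.inl l)) : KP n m c) ∈ S <;>
        by_cases h2 : (Sum.inr (Sum.inl j) : KP n m c) ∈ S <;> simp [h1, h2]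
    · rw [hA]
      simp only [← Finset.sum_neg_distrib, KConflict, KPlit]
      refine Finset.sum_congr rfl fun l _ => Finset.sum_congr rfl fun l' _ => ?_
      by_cases h1 : (Sum.inr (Sum.inr (Sum.inl l)) : KP n m c) ∈ S <;>
        by_cases h2 : (Sum.inr (Sum.inr (Sum.inl l')) : KP n m c) ∈ S <;>
        simp only [h1, h2, true_and, false_and, and_false, if_false, neg_zero, if_true]
      split_ifs <;> simp
    · rfl
  · ring

theorem Kworth_eq (S : Finset (KP n m c)) :
    Kworth c S = Kclause c S + Kvars c S - Kpen c S +
      if KPchall c ∈ S ∧ KPsat c ∈ S then Kwnorm c else 0 := by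
  have hne : KPchall c ≠ KPsat c := by simp [KPchall, KPsat]
  have hw : ∀ u v : KP n m c,
      (if (u = KPchall c ∧ v = KPsat c) ∨ (u = KPsat c ∧ v = KPchall c)
        then Kwnorm c else 0) =
      (if u = KPchall c then if v = KPsat c then Kwnorm c else 0 else 0) +
      (if u = KPsat c then if v = KPchall c then Kwnorm c else 0 else 0) := by
    intro u v
    by_cases h1 : u = KPchall c <;> by_cases h2 : u = KPsat c <;> simp_all
  rw [← Kw0_half_sum, Kworth]
  simp only [Kw, hw, Finset.sum_add_distrib]
  simp only [Finset.sum_ite_irrel, Finset.sum_ite_eq', Finset.sum_const_zero]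
  by_cases h1 : KPchall c ∈ S <;> by_cases h2 : KPsat c ∈ S <;> simp [h1, h2]
  ring

theorem Kwnorm_eq : Kwnorm c =
    1 - (Kclause c Finset.univ + Kvars c Finset.univ - Kpen c Finset.univ) := by
  rw [← Kw0_half_sum, Kwnorm]

theorem Kclause_le (h3 : ∀ j, (c j).card ≤ 3) (S : Finset (KP n m c)) :
    Kclause c S ≤ 3 * m * (2:ℝ)^(n+3) := by
  have key : ∀ j : Fin m, (∑ l : KLit n m c,
      if KPcl c j ∈ S ∧ KPlit c l ∈ S ∧ l.1.2 = j then (2:ℝ)^(n+3) else 0) ≤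
      3 * (2:ℝ)^(n+3) := by
    intro j
    rw [← Finset.sum_filter, Finset.sum_const, nsmul_eq_mul]
    gcongr
    have : (Finset.univ.filter (fun l : KLit n m c =>
        KPcl c j ∈ S ∧ KPlit c l ∈ S ∧ l.1.2 = j)).card ≤ (c j).card := by
      refine Finset.card_le_card_of_injOn (fun l => l.1.1) ?_ ?_
      · intro l hl
        have h := (Finset.mem_filter.1 hl).2.2.2
        have := l.2
        rw [h] at this
        exact this
      · intro l hl l' hl' h
        have h1 := (Finset.mem_filter.1 hl).2.2.2
        have h2 := (Finset.mem_filter.1 hl').2.2.2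
        exact Subtype.ext (Prod.ext h (h1.trans h2.symm))
    exact_mod_cast this.trans (h3 j)
  calc Kclause c S ≤ ∑ _j : Fin m, 3 * (2:ℝ)^(n+3) := Finset.sum_le_sum fun j _ => key j
    _ = 3 * m * (2:ℝ)^(n+3) := by simp; ring

theorem Kcoef_nonneg (b : Bool) (i : Fin n) : 0 ≤ Kcoef b i := by
  unfold Kcoef; split_ifs <;> positivity

theorem Kcoef_le (b : Bool) (i : Fin n) : Kcoef b i ≤ (2:ℝ)^((i:ℕ)+2) := by
  have : (1:ℝ) ≤ 2^((i:ℕ)+1) := one_le_pow₀ (by norm_num)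
  unfold Kcoef
  rw [pow_succ _ ((i:ℕ)+1)]
  split_ifs <;> linarith

theorem Kvars_le (S : Finset (KP n m c)) : Kvars c S ≤ (2:ℝ)^(n+3) := by
  have key : ∀ i : Fin n, (∑ b : Bool,
      if KPvar c i ∈ S ∧ (Sum.inr (Sum.inr (Sum.inr b)) : KP n m c) ∈ S
        then Kcoef b i else 0) ≤ 8 * (2:ℝ)^(i:ℕ) := by
    intro i
    calc _ ≤ ∑ _b : Bool, (2:ℝ)^((i:ℕ)+2) := by
          refine Finset.sum_le_sum fun b _ => ?_
          split_ifs
          · exact Kcoef_le b i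
          · positivity
      _ = 8 * (2:ℝ)^(i:ℕ) := by simp; ring
  calc Kvars c S ≤ ∑ i : Fin n, 8 * (2:ℝ)^(i:ℕ) := Finset.sum_le_sum fun i _ => key i
    _ = 8 * (2^n - 1) := by
        rw [← Finset.mul_sum, Fin.sum_univ_eq_sum_range (fun i => (2:ℝ)^i),
          geom_sum_eq (by norm_num)]
        norm_num
    _ ≤ (2:ℝ)^(n+3) := by rw [pow_add]; linarith

theorem Kpen_nonneg (S : Finset (KP n m c)) : 0 ≤ Kpen c S := by
  unfold Kpen
  positivity

theorem Kpen_unit_le : 8 * ((m:ℝ) + 1) * (2:ℝ)^(n+3) ≤ (2:ℝ)^(m+n+7) / 2 := by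
  have h : ((m:ℝ) + 1) ≤ 2^m := by exact_mod_cast Nat.lt_two_pow_self
  have : (2:ℝ)^(m+n+7) / 2 = 8 * 2^m * (2:ℝ)^(n+3) := by ring
  rw [this]
  gcongr

theorem le_Kpen_of_conflict {S : Finset (KP n m c)} {l l' : KLit n m c}
    (hl : KPlit c l ∈ S) (hl' : KPlit c l' ∈ S) (h : KConflict c l l') :
    8 * ((m:ℝ) + 1) * (2:ℝ)^(n+3) ≤ Kpen c S := by
  classical
  refine Kpen_unit_le.trans ?_
  unfold Kpen
  refine le_add_of_le_of_nonneg (div_le_div_of_nonneg_right ?_ (by norm_num)) (by positivity)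
  refine le_trans ?_ (Finset.single_le_sum (fun _ _ => by positivity) (Finset.mem_univ l))
  refine le_trans ?_ (Finset.single_le_sum (fun _ _ => by positivity) (Finset.mem_univ l'))
  rw [if_pos ⟨hl, hl', h⟩]

theorem le_Kpen_of_var {S : Finset (KP n m c)} {i : Fin n} {l : KLit n m c}
    (hi : KPvar c i ∈ S) (hl : KPlit c l ∈ S) (h : l.1.1 = (i, false)) :
    8 * ((m:ℝ) + 1) * (2:ℝ)^(n+3) ≤ Kpen c S := by
  refine (Kpen_unit_le.trans (half_le_self (by positivity))).trans ?_
  unfold Kpen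
  refine le_add_of_nonneg_of_le (by positivity) ?_
  refine le_trans ?_ (Finset.single_le_sum (fun _ _ => by positivity) (Finset.mem_univ i))
  refine le_trans ?_ (Finset.single_le_sum (fun _ _ => by positivity) (Finset.mem_univ l))
  rw [if_pos ⟨hi, hl, h⟩]

/-- The special player `sat` (`b = true`) or `chall` (`b = false`). -/
abbrev KPspecial (b : Bool) : KP n m c := Sum.inr (Sum.inr (Sum.inr b))

theorem Kvars_eq_of_special {b : Bool} {S : Finset (KP n m c)}
    (hb : KPspecial c b ∈ S) (hnb : KPspecial c (!b) ∉ S) :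
    Kvars c S = ∑ i : Fin n, if KPvar c i ∈ S then Kcoef b i else 0 := by
  unfold Kvars
  refine Finset.sum_congr rfl fun i _ => ?_
  rw [Fintype.sum_bool]
  cases b <;> simp_all [KPspecial]

theorem Kworth_eq_of_special {b : Bool} {S : Finset (KP n m c)}
    (hnb : KPspecial c (!b) ∉ S) :
    Kworth c S = Kclause c S + Kvars c S - Kpen c S := by
  rw [Kworth_eq, if_neg, add_zero]
  rintro ⟨h1, h2⟩
  cases b
  · exact hnb h2
  · exact hnb h1

theorem Kvalue_nonneg (b : Bool) (σ : Fin n → Bool) : 0 ≤ Kvalue b σ :=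
  Finset.sum_nonneg fun i _ => by
    split_ifs
    · exact Kcoef_nonneg b i
    · exact le_rfl

/-- The worth of a coalition containing exactly one of `chall` and `sat` is bounded by the
value of some satisfying assignment. -/
theorem exists_sat_Kworth_le (h3 : ∀ j, (c j).card ≤ 3) (hsat : ∃ σ, KSat c σ)
    {b : Bool} {S : Finset (KP n m c)}
    (hb : KPspecial c b ∈ S) (hnb : KPspecial c (!b) ∉ S) :
    ∃ σ, KSat c σ ∧ Kworth c S ≤ m * (2:ℝ)^(n+3) + Kvalue b σ := by
  classical
  obtain ⟨σ₀, hσ₀⟩ := hsat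
  have hQ : (0:ℝ) < 2^(n+3) := by positivity
  have hmQ : (0:ℝ) ≤ m * 2^(n+3) := by positivity
  have hc := Kclause_le c h3 S
  have hv := Kvars_le c S
  have hp := Kpen_nonneg c S
  rw [Kworth_eq_of_special c hnb]
  by_cases hbig : 8 * ((m:ℝ) + 1) * (2:ℝ)^(n+3) ≤ Kpen c S
  · refine ⟨σ₀, hσ₀, ?_⟩
    have := Kvalue_nonneg b σ₀
    linarith
  have hconf : ∀ l l' : KLit n m c, KPlit c l ∈ S → KPlit c l' ∈ S → ¬ KConflict c l l' :=
    fun l l' hl hl' h => hbig (le_Kpen_of_conflict c hl hl' h)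
  have hvar : ∀ (i : Fin n) (l : KLit n m c), KPvar c i ∈ S → KPlit c l ∈ S →
      l.1.1 ≠ (i, false) := fun i l hi hl h => hbig (le_Kpen_of_var c hi hl h)
  have hone : ∀ j : Fin m, (∑ l : KLit n m c,
      if KPcl c j ∈ S ∧ KPlit c l ∈ S ∧ l.1.2 = j then (2:ℝ)^(n+3) else 0) ≤ (2:ℝ)^(n+3) := by
    intro j
    rw [← Finset.sum_filter, Finset.sum_const, nsmul_eq_mul]
    refine mul_le_of_le_one_left hQ.le ?_
    have : (Finset.univ.filter (fun l : KLit n m c =>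
        KPcl c j ∈ S ∧ KPlit c l ∈ S ∧ l.1.2 = j)).card ≤ 1 := by
      refine Finset.card_le_one.2 fun l hl l' hl' => ?_
      obtain ⟨-, -, h1, h2⟩ := Finset.mem_filter.1 hl
      obtain ⟨-, -, h1', h2'⟩ := Finset.mem_filter.1 hl'
      by_contra hne
      refine hconf l l' h1 h1' (Or.inl ⟨h2.trans h2'.symm, fun h => hne ?_⟩)
      exact Subtype.ext (Prod.ext h (h2.trans h2'.symm))
    exact_mod_cast this
  by_cases hall : ∀ j, ∃ l : KLit n m c, KPlit c l ∈ S ∧ l.1.2 = j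
  · let σ : Fin n → Bool := fun i =>
      decide (KPvar c i ∈ S ∨ ∃ l : KLit n m c, KPlit c l ∈ S ∧ l.1.1 = (i, true))
    refine ⟨σ, fun j => ?_, ?_⟩
    · obtain ⟨l, hl, rfl⟩ := hall j
      refine ⟨l.1.1, l.2, ?_⟩
      rcases hs : l.1.1 with ⟨i, s⟩
      cases s
      · simp only [σ, decide_eq_false_iff_not, not_or, not_exists, not_and]
        refine ⟨fun hi => hvar i l hi hl hs, fun l' hl' hs' => hconf l l' hl hl' (Or.inr ?_)⟩
        simp [hs, hs']
      · simp only [σ, decide_eq_true_eq]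
        exact Or.inr ⟨l, hl, hs⟩
    · have h1 : Kclause c S ≤ m * (2:ℝ)^(n+3) := by
        calc Kclause c S ≤ ∑ _j : Fin m, (2:ℝ)^(n+3) := Finset.sum_le_sum fun j _ => hone j
          _ = m * (2:ℝ)^(n+3) := by simp
      have h2 : Kvars c S ≤ Kvalue b σ := by
        rw [Kvars_eq_of_special c hb hnb]
        refine Finset.sum_le_sum fun i _ => ?_
        by_cases hi : KPvar c i ∈ S
        · simp [σ, hi]
        · rw [if_neg hi]
          split_ifs
          · exact Kcoef_nonneg b i
          · exact le_rfl
      linarith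
  · push Not at hall
    obtain ⟨j₀, hj₀⟩ := hall
    refine ⟨σ₀, hσ₀, ?_⟩
    have h0 := Kvalue_nonneg b σ₀
    have h1 : Kclause c S + (2:ℝ)^(n+3) ≤ m * (2:ℝ)^(n+3) := by
      calc Kclause c S + (2:ℝ)^(n+3)
          = ∑ j : Fin m, ((∑ l : KLit n m c,
              if KPcl c j ∈ S ∧ KPlit c l ∈ S ∧ l.1.2 = j then (2:ℝ)^(n+3) else 0) +
              if j = j₀ then (2:ℝ)^(n+3) else 0) := by
            rw [Finset.sum_add_distrib, Finset.sum_ite_eq' Finset.univ j₀]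
            simp [Kclause]
        _ ≤ ∑ _j : Fin m, (2:ℝ)^(n+3) := by
            refine Finset.sum_le_sum fun j _ => ?_
            by_cases hj : j = j₀
            · subst hj
              rw [Finset.sum_eq_zero, if_pos rfl, zero_add]
              intro l _
              exact if_neg fun h => hj₀ l h.2.1 h.2.2
            · rw [if_neg hj, add_zero]
              exact hone j
        _ = m * (2:ℝ)^(n+3) := by simp
    linarith

/-- Every satisfying assignment yields a coalition of the corresponding worth that contains
exactly one of `chall` and `sat`. -/
theorem exists_le_Kworth_of_sat (b : Bool) {σ : Fin n → Bool} (hσ : KSat c σ) :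
    ∃ S : Finset (KP n m c), KPspecial c b ∈ S ∧ KPspecial c (!b) ∉ S ∧
      m * (2:ℝ)^(n+3) + Kvalue b σ ≤ Kworth c S := by
  classical
  choose f hf hfσ using hσ
  let S : Finset (KP n m c) := Finset.univ.filter fun u : KP n m c =>
    Sum.elim (fun i => σ i = true) (Sum.elim (fun _ => True)
      (Sum.elim (fun l : KLit n m c => l.1.1 = f l.1.2) (fun b' => b' = b))) u
  have hSb : KPspecial c b ∈ S := by simp [S, KPspecial]
  have hSnb : KPspecial c (!b) ∉ S := by simp [S, KPspecial]
  have hSvar : ∀ i, KPvar c i ∈ S ↔ σ i = true := by simp [S, KPvar]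
  have hScl : ∀ j, KPcl c j ∈ S := by simp [S, KPcl]
  have hSlit : ∀ l : KLit n m c, KPlit c l ∈ S ↔ l.1.1 = f l.1.2 := by simp [S, KPlit]
  refine ⟨S, hSb, hSnb, ?_⟩
  rw [Kworth_eq_of_special c hSnb]
  have hp : Kpen c S = 0 := by
    unfold Kpen
    rw [Finset.sum_eq_zero, Finset.sum_eq_zero]
    · simp
    · intro i _
      refine Finset.sum_eq_zero fun l _ => if_neg ?_
      rintro ⟨h1, h2, h3⟩
      rw [hSvar] at h1
      rw [hSlit] at h2
      have := hfσ l.1.2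
      rw [← h2, h3] at this
      simp_all
    · intro l _
      refine Finset.sum_eq_zero fun l' _ => if_neg ?_
      rintro ⟨h1, h2, h3⟩
      rw [hSlit] at h1 h2
      rcases h3 with ⟨h, hne⟩ | ⟨h, hne⟩
      · exact hne (by rw [h1, h2, h])
      · apply hne
        have e1 := hfσ l.1.2
        have e2 := hfσ l'.1.2
        rw [← h1] at e1
        rw [← h2] at e2
        rw [← e1, ← e2, h]
  have hv : Kvars c S = Kvalue b σ := by
    rw [Kvars_eq_of_special c hSb hSnb, Kvalue]
    simp only [hSvar]
  have hcl : m * (2:ℝ)^(n+3) ≤ Kclause c S := by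
    calc m * (2:ℝ)^(n+3) = ∑ _j : Fin m, (2:ℝ)^(n+3) := by simp
      _ ≤ Kclause c S := by
        refine Finset.sum_le_sum fun j _ => ?_
        refine le_trans ?_ (Finset.single_le_sum (fun _ _ => by positivity)
          (Finset.mem_univ (⟨(f j, j), hf j⟩ : KLit n m c)))
        rw [if_pos ⟨hScl j, (hSlit _).2 rfl, rfl⟩]
  linarith

theorem sum_Kx (S : Finset (KP n m c)) :
    ∑ k ∈ S, Kx c k = if KPsat c ∈ S then 1 else 0 := by
  simp only [Kx, Finset.sum_ite_eq']

theorem Ksurplus_le {i j : KP n m c} (hij : i ≠ j) {x : KP n m c → ℝ} {r : ℝ}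
    (h : ∀ S : Finset (KP n m c), i ∈ S → j ∉ S → Kworth c S - ∑ k ∈ S, x k ≤ r) :
    Ksurplus c i j x ≤ r := by
  refine Finset.sup'_le _ _ fun S hS => ?_
  rcases Finset.mem_insert.1 hS with rfl | hS
  · exact h _ (Finset.mem_singleton_self i) (by simpa using hij.symm)
  · obtain ⟨-, h1, h2⟩ := Finset.mem_filter.1 hS
    exact h S h1 h2

theorem le_Ksurplus {i j : KP n m c} (x : KP n m c → ℝ) {S : Finset (KP n m c)}
    (hi : i ∈ S) (hj : j ∉ S) : Kworth c S - ∑ k ∈ S, x k ≤ Ksurplus c i j x :=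
  Finset.le_sup' (fun S => Kworth c S - ∑ k ∈ S, x k)
    (Finset.mem_insert_of_mem (Finset.mem_filter.2 ⟨Finset.mem_univ S, hi, hj⟩))

theorem Kworth_singleton (p : KP n m c) : Kworth c {p} = 0 := by
  rcases p with i | j | l | b <;>
    simp [Kworth, Kw, Kw0, KPchall, KPsat]

theorem KIsImputation_Kx : KIsImputation c (Kx c) := by
  refine ⟨?_, fun p => ?_⟩
  · rw [sum_Kx, Kworth_eq, Kwnorm_eq]
    simp
  · rw [Kworth_singleton, Kx]
    split_ifs <;> norm_num

/-- The normalizer edge outweighs every coalition avoiding `sat`. -/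
theorem Kworth_le_Kwnorm (h3 : ∀ j, (c j).card ≤ 3) (h2 : ∃ j, 2 ≤ (c j).card)
    {S : Finset (KP n m c)} (hS : KPsat c ∉ S) : Kworth c S ≤ Kwnorm c - 1 := by
  obtain ⟨j, hj⟩ := h2
  obtain ⟨a, ha, a', ha', hne⟩ := Finset.one_lt_card.1 hj
  have hpen := le_Kpen_of_conflict c (Finset.mem_univ (KPlit c ⟨(a, j), ha⟩))
    (Finset.mem_univ (KPlit c ⟨(a', j), ha'⟩)) (Or.inl ⟨rfl, hne⟩)
  have hmQ : (0:ℝ) ≤ m * 2^(n+3) := by positivity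
  have hQ : (0:ℝ) < 2^(n+3) := by positivity
  rw [Kworth_eq, Kwnorm_eq, if_neg fun h => hS h.2]
  have h1 := Kclause_le c h3 S
  have h2 := Kvars_le c S
  have h4 := Kclause_le c h3 Finset.univ
  have h5 := Kvars_le c Finset.univ
  have h6 := Kpen_nonneg c S
  linarith

theorem Kworth_chall_sat : Kworth c {KPchall c, KPsat c} = Kwnorm c := by
  rw [Kworth_eq]
  simp [Kclause, Kvars, Kpen, KPchall, KPsat, KPcl, KPlit, KPvar]

theorem KInKernel_Kx_iff (h3 : ∀ j, (c j).card ≤ 3) (h2 : ∃ j, 2 ≤ (c j).card) :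
    KInKernel c (Kx c) ↔
      Ksurplus c (KPchall c) (KPsat c) (Kx c) ≤ Ksurplus c (KPsat c) (KPchall c) (Kx c) := by
  have hne : KPchall c ≠ KPsat c := by simp [KPchall, KPsat]
  constructor
  · rintro ⟨-, h⟩
    by_contra! hlt
    have := h _ _ hne hlt
    rw [Kworth_singleton] at this
    simp [Kx] at this
  · refine fun h => ⟨KIsImputation_Kx c, fun i j hij hlt => ?_⟩
    rw [Kworth_singleton]
    by_cases hj : j = KPsat c
    · subst hj
      exfalso
      by_cases hi : i = KPchall c
      · subst hi
        exact absurd h (not_le.2 hlt)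
      · refine absurd ?_ (not_le.2 hlt)
        have hlow := le_Ksurplus c (i := KPsat c) (j := i) (Kx c)
          (S := {KPchall c, KPsat c}) (by simp) (by simp [hi, hij])
        rw [Kworth_chall_sat, sum_Kx, if_pos (by simp)] at hlow
        refine (Ksurplus_le c hij fun S _ hS => ?_).trans hlow
        rw [sum_Kx, if_neg hS, sub_zero]
        exact Kworth_le_Kwnorm c h3 h2 hS
    · exact if_neg hj

theorem Kvalue_eq (hn : 0 < n) (b : Bool) (σ : Fin n → Bool) :
    Kvalue b σ = Kval σ + if b = true ∧ σ ⟨0, hn⟩ = true then 1 else 0 := by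
  have h : ∀ i : Fin n, (if σ i = true then Kcoef b i else 0) =
      (if σ i = true then (2:ℝ)^((i:ℕ)+1) else 0) +
      if i = ⟨0, hn⟩ then (if b = true ∧ σ ⟨0, hn⟩ = true then 1 else 0) else 0 := by
    intro i
    by_cases hi : i = ⟨0, hn⟩
    · subst hi
      by_cases hs : σ ⟨0, hn⟩ = true <;> simp [Kcoef, hs]
    · have : (i:ℕ) ≠ 0 := fun h => hi (Fin.ext h)
      simp [Kcoef, hi, this]
  rw [Kvalue, Kval, Finset.sum_congr rfl fun i _ => h i, Finset.sum_add_distrib]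
  simp

theorem Kval_add_one_le {σ σ' : Fin n → Bool} (h : Kval σ < Kval σ') :
    Kval σ + 1 ≤ Kval σ' := by
  have key : ∀ τ : Fin n → Bool,
      Kval τ = ((∑ i : Fin n, if τ i then 2^((i:ℕ)+1) else 0 : ℕ) : ℝ) := by
    intro τ
    simp [Kval]
  rw [key, key] at h ⊢
  exact_mod_cast h

/--
**Kernel membership and the lexicographically maximum satisfying assignment.**
Let `φ` be a satisfiable 3CNF formula over variables `α₁, …, α_n`, with clauses
`c₁, …, c_m`, in which some clause contains at least two literals, and let `x` be the
imputation of `K(φ)` assigning `1` to `sat` and `0` to every other player.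
Then `x` belongs to the kernel of `K(φ)` if and only if `α₁` evaluates to true in the
lexicographically maximum satisfying assignment of `φ`, i.e. in the satisfying assignment
`σ` maximizing `∑_{α_i : σ(α_i) = true} 2^i`.
-/
theorem K_kernel_iff_lexmax_first_var_true (n m : ℕ) (hn : 0 < n)
    (c : Fin m → Finset (Fin n × Bool))
    (h3 : ∀ j, (c j).card ≤ 3) (h2 : ∃ j, 2 ≤ (c j).card)
    (hsat : ∃ σ, KSat c σ) :
    KInKernel c (Kx c) ↔
      ∃ σ : Fin n → Bool, KSat c σ ∧ (∀ σ', KSat c σ' → Kval σ' ≤ Kval σ) ∧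
        σ ⟨0, hn⟩ = true := by
  classical
  obtain ⟨σ₀, hσ₀, hmax⟩ := Finset.exists_max_image (Finset.univ.filter (KSat c)) Kval
    (hsat.imp fun σ hσ => Finset.mem_filter.2 ⟨Finset.mem_univ σ, hσ⟩)
  replace hσ₀ : KSat c σ₀ := (Finset.mem_filter.1 hσ₀).2
  replace hmax : ∀ σ, KSat c σ → Kval σ ≤ Kval σ₀ := fun σ hσ =>
    hmax σ (Finset.mem_filter.2 ⟨Finset.mem_univ σ, hσ⟩)
  have hne : KPchall c ≠ KPsat c := by simp [KPchall, KPsat]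
  rw [KInKernel_Kx_iff c h3 h2]
  constructor
  · intro h
    by_contra! hno
    obtain ⟨S, hS, hS', hle⟩ := exists_le_Kworth_of_sat c false hσ₀
    replace hS' : KPsat c ∉ S := hS'
    have hlow := le_Ksurplus c (i := KPchall c) (j := KPsat c) (Kx c) hS hS'
    rw [sum_Kx, if_neg hS'] at hlow
    rw [Kvalue_eq hn] at hle
    have hup : Ksurplus c (KPsat c) (KPchall c) (Kx c) ≤
        m * (2:ℝ)^(n+3) + Kval σ₀ - 1 := by
      refine Ksurplus_le c hne.symm fun T hT hT' => ?_
      rw [sum_Kx, if_pos hT]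
      obtain ⟨σ, hσ, hσT⟩ := exists_sat_Kworth_le c h3 hsat (b := true) hT hT'
      have : Kvalue true σ ≤ Kval σ₀ := by
        rw [Kvalue_eq hn]
        by_cases h0 : σ ⟨0, hn⟩ = true
        · simp only [h0, and_self, if_true]
          refine Kval_add_one_le (lt_of_not_ge fun hge => ?_)
          exact hno σ hσ (fun σ' hσ' => (hmax σ' hσ').trans hge) h0
        · simpa [h0] using hmax σ hσ
      linarith
    simp at hle
    linarith
  · rintro ⟨σ, hσ, hσmax, h0⟩
    obtain ⟨S, hS, hS', hle⟩ := exists_le_Kworth_of_sat c true hσ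
    replace hS : KPsat c ∈ S := hS
    have hlow := le_Ksurplus c (i := KPsat c) (j := KPchall c) (Kx c) hS hS'
    rw [sum_Kx, if_pos hS] at hlow
    rw [Kvalue_eq hn, if_pos ⟨rfl, h0⟩] at hle
    have hup : Ksurplus c (KPchall c) (KPsat c) (Kx c) ≤ m * (2:ℝ)^(n+3) + Kval σ := by
      refine Ksurplus_le c hne fun T hT hT' => ?_
      rw [sum_Kx, if_neg hT', sub_zero]
      obtain ⟨τ, hτ, hτT⟩ := exists_sat_Kworth_le c h3 hsat (b := false) hT hT'
      have := hσmax τ hτ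
      rw [Kvalue_eq hn] at hτT
      simp at hτT
      linarith
    linarith
end

section
/- Let Φ be an NQBF₂,∀ formula with n universally quantified variables and 3CNF matrix φ with m clauses, let BS(Φ) be the associated graph game, and let x be the imputation assigning m to sat, n−1 to chall, and 0 to every other player. Then no player of BS(Φ) has a justified objection to x against any clause player c_j or any literal player ℓ_{i,j}. -/
set_option synthInstance.maxSize 1000
set_option maxHeartbeats 1000000

/-!
The graph game `BS(Φ)` associated with an `NQBF₂,∀` formula
`Φ = (∀α)(∃β) φ(α, β)`, where `α = {α₁, …, α_n}` are the universally quantified variables,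
`β = {β₁, …, β_r}` the existentially quantified ones, and `φ = c₁ ∧ … ∧ c_m` is a 3CNF
formula in which each universal variable `α_k` occurs only in the two clauses
`c_{i(k)} = (α_k ∨ ¬β_k)` and `c_{ī(k)} = (¬α_k ∨ β_k)`.

A variable is an element of `Fin n ⊕ Fin r` (`Sum.inl` = universal, `Sum.inr` =
existential); a literal is a variable together with a sign (`true` = positive); a clause
is the finset of its literals, so `φ` is given by
`c : Fin m → Finset ((Fin n ⊕ Fin r) × Bool)`.
-/

/-- The variables of the matrix of `Φ`. -/
abbrev BVar (n r : ℕ) := Fin n ⊕ Fin r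

/-- Literal occurrences: a literal together with a clause it occurs in. -/
abbrev BLit (n r m : ℕ) (c : Fin m → Finset (BVar n r × Bool)) :=
  {p : (BVar n r × Bool) × Fin m // p.1 ∈ c p.2}

/-- The players of the graph game `BS(Φ)`: clause players, literal players, and the
special players `chall` (encoded by `false`) and `sat` (encoded by `true`). -/
abbrev BP (n r m : ℕ) (c : Fin m → Finset (BVar n r × Bool)) :=
  Fin m ⊕ (BLit n r m c ⊕ Bool)

variable {n r m : ℕ} (c : Fin m → Finset (BVar n r × Bool))

/-- The clause player `c_j`. -/
def BPcl (j : Fin m) : BP n r m c := Sum.inl j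
/-- The literal player `ℓ_{i,j}`. -/
def BPlit (l : BLit n r m c) : BP n r m c := Sum.inr (Sum.inl l)
/-- The player `chall`. -/
def BPchall : BP n r m c := Sum.inr (Sum.inr false)
/-- The player `sat`. -/
def BPsat : BP n r m c := Sum.inr (Sum.inr true)

/-- The (symmetric) edge-weight function of `BS(Φ)`, excluding the normalizer edge
`{chall, sat}`; `Bw0 c u v = 0` when `{u, v}` is not an edge.
Positive edges, of weight `1`: `{c_j, ℓ_{i,j}}` for each literal occurrence and
`{chall, ℓ_{i,j}}` for each occurrence of a literal over a universally quantified
variable.  Penalty edges, of weight `−m−1`: pairs of distinct literal occurrences in the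
same clause, opposite occurrences of the same variable, `{chall, ℓ_{i,j}}` for each
occurrence of a literal over an existentially quantified variable, and `{chall, c_j}`
for each clause. -/
noncomputable def Bw0 : BP n r m c → BP n r m c → ℝ := fun u v =>
  match u, v with
  | Sum.inl j, Sum.inr (Sum.inl l) => if l.1.2 = j then 1 else 0
  | Sum.inr (Sum.inl l), Sum.inl j => if l.1.2 = j then 1 else 0
  | Sum.inr (Sum.inr false), Sum.inr (Sum.inl l) =>
      (match l.1.1.1 with
       | Sum.inl _ => 1
       | Sum.inr _ => -((m:ℝ)+1))
  | Sum.inr (Sum.inl l), Sum.inr (Sum.inr false) =>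
      (match l.1.1.1 with
       | Sum.inl _ => 1
       | Sum.inr _ => -((m:ℝ)+1))
  | Sum.inr (Sum.inl l), Sum.inr (Sum.inl l') =>
      if (l.1.2 = l'.1.2 ∧ l.1.1 ≠ l'.1.1) ∨ (l.1.1.1 = l'.1.1.1 ∧ l.1.1.2 ≠ l'.1.1.2)
      then -((m:ℝ)+1) else 0
  | Sum.inr (Sum.inr false), Sum.inl _ => -((m:ℝ)+1)
  | Sum.inl _, Sum.inr (Sum.inr false) => -((m:ℝ)+1)
  | _, _ => 0

/-- The weight of the normalizer edge `{chall, sat}`: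
`n − 1 + m` minus the sum of the weights of all other edges. -/
noncomputable def Bwnorm : ℝ :=
  (n : ℝ) - 1 + (m : ℝ) - (∑ u : BP n r m c, ∑ v : BP n r m c, Bw0 c u v) / 2

/-- The full (symmetric) edge-weight function of `BS(Φ)`. -/
noncomputable def Bw (u v : BP n r m c) : ℝ :=
  Bw0 c u v +
    (if (u = BPchall c ∧ v = BPsat c) ∨ (u = BPsat c ∧ v = BPchall c) then Bwnorm c else 0)

/-- The worth of a coalition `S` in the graph game `BS(Φ)`: the sum of the weights of all
edges contained in `S` (written via the symmetric weight function). -/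
noncomputable def Bworth (S : Finset (BP n r m c)) : ℝ := (∑ u ∈ S, ∑ v ∈ S, Bw c u v) / 2

/-- The payoff vector assigning `m` to `sat`, `n − 1` to `chall`, and `0` to every other
player. -/
noncomputable def Bx : BP n r m c → ℝ := fun p =>
  if p = BPsat c then (m : ℝ) else if p = BPchall c then (n : ℝ) - 1 else 0

/-- `x` is an imputation: efficient and individually rational. -/
def BIsImputation (x : BP n r m c → ℝ) : Prop :=
  (∑ p, x p) = Bworth c Finset.univ ∧ ∀ p, x p ≥ Bworth c {p}

/-- `(y, S)` is an objection of player `i` against player `j` to the payoff vector `x`. -/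
def BObjection (x : BP n r m c → ℝ) (i j : BP n r m c)
    (S : Finset (BP n r m c)) (y : BP n r m c → ℝ) : Prop :=
  i ∈ S ∧ j ∉ S ∧ (∑ k ∈ S, y k) = Bworth c S ∧ ∀ k ∈ S, y k > x k

/-- `(z, T)` is a counterobjection to the objection `(y, S)` of `i` against `j` to `x`. -/
def BCounter (x : BP n r m c → ℝ) (i j : BP n r m c)
    (S : Finset (BP n r m c)) (y : BP n r m c → ℝ)
    (T : Finset (BP n r m c)) (z : BP n r m c → ℝ) : Prop :=
  j ∈ T ∧ i ∉ T ∧ (∑ k ∈ T, z k) = Bworth c T ∧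
    (∀ k ∈ T \ S, z k ≥ x k) ∧ (∀ k ∈ T ∩ S, z k ≥ y k)

/-- `(y, S)` is a justified objection of `i` against `j` to `x`: an objection admitting
no counterobjection. -/
def BJustified (x : BP n r m c → ℝ) (i j : BP n r m c)
    (S : Finset (BP n r m c)) (y : BP n r m c → ℝ) : Prop :=
  BObjection c x i j S y ∧ ∀ T z, ¬ BCounter c x i j S y T z

/-- Validity of the `NQBF₂,∀` formula `Φ`: for every assignment of the universally
quantified variables there is an assignment of the existentially quantified variables
satisfying every clause of the matrix. -/
def BValid : Prop :=
  ∀ a : Fin n → Bool, ∃ bb : Fin r → Bool,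
    ∀ j : Fin m, ∃ l ∈ c j, Sum.elim a bb l.1 = l.2

/-- A player of zero worth and zero payoff can counter every objection on its own. -/
theorem not_BJustified_of_worth_eq_zero (x : BP n r m c → ℝ) (i j : BP n r m c)
    (S : Finset (BP n r m c)) (y : BP n r m c → ℝ)
    (hx : x j = 0) (hw : Bworth c {j} = 0) : ¬ BJustified c x i j S y := by
  rintro ⟨⟨hi, hj, -, -⟩, hno⟩
  refine hno {j} (fun _ => 0) ⟨Finset.mem_singleton_self j, ?_, ?_, ?_, ?_⟩
  · intro h
    exact hj (Finset.mem_singleton.1 h ▸ hi)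
  · simp [hw]
  · intro k hk
    obtain rfl := Finset.mem_singleton.1 (Finset.mem_sdiff.1 hk).1
    exact hx.le
  · intro k hk
    obtain ⟨hkj, hkS⟩ := Finset.mem_inter.1 hk
    exact absurd (Finset.mem_singleton.1 hkj ▸ hkS) hj

/--
**No justified objection against clause or literal players.**
Let `Φ` be an `NQBF₂,∀` formula, `BS(Φ)` the associated graph game, and `x` the
imputation assigning `m` to `sat`, `n − 1` to `chall`, and `0` to every other player.
Then no player of `BS(Φ)` has a justified objection to `x` against any clause player
`c_j` or any literal player `ℓ_{i,j}`.
-/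
theorem BS_no_justified_objection_against_clause_or_literal (n r m : ℕ) (hnr : n ≤ r)
    (c : Fin m → Finset (BVar n r × Bool)) (ci cbar : Fin n → Fin m)
    (h3 : ∀ j, (c j).card ≤ 3)
    (hci : ∀ k : Fin n,
      c (ci k) = {((Sum.inl k : BVar n r), true),
                  ((Sum.inr (Fin.castLE hnr k) : BVar n r), false)})
    (hcbar : ∀ k : Fin n,
      c (cbar k) = {((Sum.inl k : BVar n r), false),
                    ((Sum.inr (Fin.castLE hnr k) : BVar n r), true)})
    (honly : ∀ (k : Fin n) (j : Fin m) (b : Bool),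
      ((Sum.inl k : BVar n r), b) ∈ c j → j = (if b = true then ci k else cbar k)) :
    (∀ (i : BP n r m c) (j : Fin m) (S : Finset (BP n r m c)) (y : BP n r m c → ℝ),
      ¬ BJustified c (Bx c) i (BPcl c j) S y) ∧
    (∀ (i : BP n r m c) (l : BLit n r m c) (S : Finset (BP n r m c)) (y : BP n r m c → ℝ),
      ¬ BJustified c (Bx c) i (BPlit c l) S y) := by
  constructor
  · intro i j S y
    apply not_BJustified_of_worth_eq_zero
    · simp [Bx, BPcl, BPsat, BPchall]
    · simp [Bworth, Bw, Bw0, BPcl, BPsat, BPchall]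
  · intro i l S y
    apply not_BJustified_of_worth_eq_zero
    · simp [Bx, BPlit, BPsat, BPchall]
    · simp [Bworth, Bw, Bw0, BPlit, BPsat, BPchall]
end

section
/- Let Φ be an NQBF₂,∀ formula with n universally quantified variables and 3CNF matrix φ with m clauses, let BS(Φ) be the associated graph game, and let x be the imputation assigning m to sat, n−1 to chall, and 0 to every other player. Then no player of BS(Φ) has a justified objection to x against the player chall. -/
set_option synthInstance.maxSize 1000
set_option maxHeartbeats 1000000

variable {n r m : ℕ} (c : Fin m → Finset (BVar n r × Bool))

/-- The weight between two literal occurrences is nonpositive. -/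
lemma Bw0_lit_lit_nonpos (l l' : BLit n r m c) :
    Bw0 c (Sum.inr (Sum.inl l)) (Sum.inr (Sum.inl l')) ≤ 0 := by
  have hm : (0 : ℝ) ≤ m := m.cast_nonneg
  simp only [Bw0]
  split_ifs <;> linarith

/-- Distinct literal occurrences in the same clause are joined by a penalty edge. -/
lemma Bw0_lit_lit_of_same_clause {l l' : BLit n r m c} (hne : l ≠ l') (h : l.1.2 = l'.1.2) :
    Bw0 c (Sum.inr (Sum.inl l)) (Sum.inr (Sum.inl l')) = -((m : ℝ) + 1) := by
  have hlit : l.1.1 ≠ l'.1.1 := fun h' => hne (Subtype.ext (Prod.ext h' h))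
  simp only [Bw0]
  exact if_pos (Or.inl ⟨h, hlit⟩)

/-- A family of literal occurrences no two of which share a clause has at most `m` members. -/
lemma card_lits_le_of_injOn (A : Finset (BLit n r m c))
    (h : Set.InjOn (fun l : BLit n r m c => l.1.2) A) : (A.card : ℝ) ≤ m := by
  have := Finset.card_le_card_of_injOn (t := Finset.univ) (fun l : BLit n r m c => l.1.2)
    (fun _ _ => Finset.mem_coe.2 (Finset.mem_univ _)) h
  rw [Finset.card_univ, Fintype.card_fin] at this
  exact_mod_cast this

/-- Literal and clause players without `chall` generate weight at most one per clause. -/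
lemma sum_lits_le (A : Finset (BLit n r m c)) :
    2 * (A.card : ℝ) + ∑ l ∈ A, ∑ l' ∈ A, Bw0 c (Sum.inr (Sum.inl l)) (Sum.inr (Sum.inl l'))
      ≤ 2 * m := by
  classical
  set alone := A.filter (fun l => ∀ l' ∈ A, l.1.2 = l'.1.2 → l = l') with halone
  have hcard : (alone.card : ℝ) ≤ m := by
    refine card_lits_le_of_injOn c alone fun l hl l' hl' h => ?_
    rw [halone, Finset.mem_coe, Finset.mem_filter] at hl hl'
    exact hl.2 l' hl'.1 h
  have hterm : ∀ l ∈ A, 2 + ∑ l' ∈ A, Bw0 c (Sum.inr (Sum.inl l)) (Sum.inr (Sum.inl l'))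
      ≤ if ∀ l' ∈ A, l.1.2 = l'.1.2 → l = l' then (2 : ℝ) else 0 := by
    intro l _
    split_ifs with h
    · linarith [Finset.sum_nonpos fun l' (_ : l' ∈ A) => Bw0_lit_lit_nonpos c l l']
    · push Not at h
      obtain ⟨l', hl', hcl, hne⟩ := h
      have hm : (1 : ℝ) ≤ m := by exact_mod_cast Fin.pos l.1.2
      rw [← Finset.add_sum_erase A _ hl', Bw0_lit_lit_of_same_clause c hne hcl]
      linarith [Finset.sum_nonpos fun l'' (_ : l'' ∈ A.erase l') => Bw0_lit_lit_nonpos c l l'']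
  have hsum := Finset.sum_le_sum hterm
  rw [Finset.sum_add_distrib, Finset.sum_const, nsmul_eq_mul, ← Finset.sum_filter,
    Finset.sum_const, nsmul_eq_mul] at hsum
  linarith

/-- A coalition without `chall` is worth at most `m`. -/
lemma Bworth_le_of_chall_notMem (S : Finset (BP n r m c)) (hS : BPchall c ∉ S) :
    Bworth c S ≤ m := by
  classical
  have hBw : ∀ u ∈ S, ∀ v ∈ S, Bw c u v = Bw0 c u v := by
    intro u hu v hv
    rw [Bw, if_neg, add_zero]
    rintro (⟨rfl, _⟩ | ⟨_, rfl⟩)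
    exacts [hS hu, hS hv]
  have hB : false ∉ S.toRight.toRight := by
    simpa [BPchall] using hS
  set C := S.toLeft
  set A := S.toRight.toLeft
  set B := S.toRight.toRight
  have hdecomp : S = C.disjSum (A.disjSum B) := by
    simp only [C, A, B, Finset.toLeft_disjSum_toRight]
  have hsplit : ∑ u ∈ S, ∑ v ∈ S, Bw0 c u v =
      2 * ∑ l ∈ A, (if l.1.2 ∈ C then (1 : ℝ) else 0) +
        ∑ l ∈ A, ∑ l' ∈ A, Bw0 c (Sum.inr (Sum.inl l)) (Sum.inr (Sum.inl l')) := by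
    have hB' : B = ∅ ∨ B = {true} := by
      rw [← Finset.subset_singleton_iff]
      intro b hb
      cases b
      · exact absurd hb hB
      · simp
    rw [hdecomp]
    have hswap : ∑ j ∈ C, ∑ l ∈ A, (if l.1.2 = j then (1 : ℝ) else 0) =
        ∑ l ∈ A, ∑ j ∈ C, (if l.1.2 = j then (1 : ℝ) else 0) := Finset.sum_comm
    rcases hB' with h | h <;> rw [h] <;>
      simp [-Finset.sum_boole, Finset.sum_disjSum, Bw0, Finset.sum_add_distrib, hswap] <;> ring
  have hle : ∑ l ∈ A, (if l.1.2 ∈ C then (1 : ℝ) else 0) ≤ A.card := by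
    rw [Finset.sum_boole]
    exact_mod_cast Finset.card_filter_le _ _
  rw [Bworth, Finset.sum_congr rfl fun u hu => Finset.sum_congr rfl (hBw u hu), hsplit]
  linarith [sum_lits_le c A]

/-- If every clause contains at most one literal over a universal variable, the edges other
than the normalizer have nonpositive total weight. -/
lemma sum_Bw0_nonpos
    (h : ∀ (j : Fin m) (k k' : Fin n) (b b' : Bool), ((Sum.inl k : BVar n r), b) ∈ c j →
      ((Sum.inl k' : BVar n r), b') ∈ c j → k = k' ∧ b = b') :
    ∑ u : BP n r m c, ∑ v : BP n r m c, Bw0 c u v ≤ 0 := by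
  classical
  have hswap : ∑ j : Fin m, ∑ l : BLit n r m c, (if l.1.2 = j then (1 : ℝ) else 0) =
      ∑ l : BLit n r m c, ∑ j : Fin m, (if l.1.2 = j then (1 : ℝ) else 0) := Finset.sum_comm
  have hsplit : ∑ u : BP n r m c, ∑ v : BP n r m c, Bw0 c u v =
      2 * ∑ l : BLit n r m c,
          (1 + Bw0 c (Sum.inr (Sum.inl l)) (Sum.inr (Sum.inr false))) +
        ∑ l : BLit n r m c, ∑ l' : BLit n r m c,
          Bw0 c (Sum.inr (Sum.inl l)) (Sum.inr (Sum.inl l')) - 2 * (m * (m + 1)) := by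
    simp only [Fintype.sum_sum_type, Fintype.sum_bool, Bw0, Finset.sum_add_distrib, hswap]
    simp
    ring
  have hpen : ∑ l : BLit n r m c, ∑ l' : BLit n r m c,
      Bw0 c (Sum.inr (Sum.inl l)) (Sum.inr (Sum.inl l')) ≤ 0 :=
    Finset.sum_nonpos fun l _ => Finset.sum_nonpos fun l' _ => Bw0_lit_lit_nonpos c l l'
  set U := (Finset.univ : Finset (BLit n r m c)).filter (fun l => l.1.1.1.isLeft) with hU
  have hcard : (U.card : ℝ) ≤ m := by
    refine card_lits_le_of_injOn c U ?_
    rintro ⟨⟨⟨v, b⟩, j⟩, hl⟩ hv ⟨⟨⟨v', b'⟩, j'⟩, hl'⟩ hv' hj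
    obtain rfl : j = j' := hj
    rw [hU, Finset.mem_coe, Finset.mem_filter] at hv hv'
    obtain ⟨k, rfl⟩ := Sum.isLeft_iff.1 hv.2
    obtain ⟨k', rfl⟩ := Sum.isLeft_iff.1 hv'.2
    obtain ⟨rfl, rfl⟩ := h j k k' b b' hl hl'
    rfl
  have hpos : ∑ l : BLit n r m c,
      (1 + Bw0 c (Sum.inr (Sum.inl l)) (Sum.inr (Sum.inr false))) ≤ 2 * U.card := by
    calc _ ≤ ∑ l : BLit n r m c, (if l.1.1.1.isLeft then (2 : ℝ) else 0) := by
          refine Finset.sum_le_sum ?_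
          rintro ⟨⟨⟨v | v, b⟩, j⟩, hl⟩ _
          · norm_num [Bw0]
          · simp [Bw0]
      _ = 2 * U.card := by
          rw [← Finset.sum_filter, Finset.sum_const, nsmul_eq_mul, mul_comm]
  have hsq : (m : ℝ) ≤ m * m := by exact_mod_cast Nat.le_mul_self m
  rw [hsplit]
  linarith

/--
**No justified objection against `chall`.**
Let `Φ` be an `NQBF₂,∀` formula, `BS(Φ)` the associated graph game, and `x` the
imputation assigning `m` to `sat`, `n − 1` to `chall`, and `0` to every other player.
Then no player of `BS(Φ)` has a justified objection to `x` against the player `chall`.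
-/
theorem BS_no_justified_objection_against_chall (n r m : ℕ) (hnr : n ≤ r)
    (c : Fin m → Finset (BVar n r × Bool)) (ci cbar : Fin n → Fin m)
    (h3 : ∀ j, (c j).card ≤ 3)
    (hci : ∀ k : Fin n,
      c (ci k) = {((Sum.inl k : BVar n r), true),
                  ((Sum.inr (Fin.castLE hnr k) : BVar n r), false)})
    (hcbar : ∀ k : Fin n,
      c (cbar k) = {((Sum.inl k : BVar n r), false),
                    ((Sum.inr (Fin.castLE hnr k) : BVar n r), true)})
    (honly : ∀ (k : Fin n) (j : Fin m) (b : Bool),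
      ((Sum.inl k : BVar n r), b) ∈ c j → j = (if b = true then ci k else cbar k)) :
    ∀ (i : BP n r m c) (S : Finset (BP n r m c)) (y : BP n r m c → ℝ),
      ¬ BJustified c (Bx c) i (BPchall c) S y := by
  classical
  rintro i S y ⟨⟨hiS, hS, hy, hgt⟩, hno⟩
  have hworth := Bworth_le_of_chall_notMem c S hS
  have hne : BPchall c ≠ BPsat c := by simp [BPchall, BPsat]
  have hxsat : Bx c (BPsat c) = m := if_pos rfl
  have hxchall : Bx c (BPchall c) = (n : ℝ) - 1 := by rw [Bx, if_neg hne, if_pos rfl]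
  have hsat : BPsat c ∉ S := by
    intro hsat
    have hx : ∑ k ∈ S, Bx c k = m := by
      rw [Finset.sum_eq_single_of_mem _ hsat, hxsat]
      intro k hk hk'
      rw [Bx, if_neg hk', if_neg (by rintro rfl; exact hS hk)]
    linarith [Finset.sum_lt_sum_of_nonempty ⟨_, hsat⟩ hgt]
  have hone : ∀ (j : Fin m) (k k' : Fin n) (b b' : Bool), ((Sum.inl k : BVar n r), b) ∈ c j →
      ((Sum.inl k' : BVar n r), b') ∈ c j → k = k' ∧ b = b' := by
    intro j k k' b b' hb hb'
    have hj := honly k j b hb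
    cases b
    · rw [if_neg (by simp)] at hj
      rw [hj, hcbar] at hb'
      simpa [eq_comm] using hb'
    · rw [if_pos rfl] at hj
      rw [hj, hci] at hb'
      simpa [eq_comm] using hb'
  have hnorm : (n : ℝ) - 1 + m ≤ Bwnorm c := by
    rw [Bwnorm]
    linarith [sum_Bw0_nonpos c hone]
  have hpair : Bworth c {BPchall c, BPsat c} = Bwnorm c := by
    rw [Bworth, Finset.sum_pair hne, Finset.sum_pair hne, Finset.sum_pair hne]
    simp [Bw, Bw0, BPchall, BPsat]
  refine hno {BPchall c, BPsat c}
    (fun p => if p = BPsat c then Bwnorm c - ((n : ℝ) - 1) else (n : ℝ) - 1)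
    ⟨by simp, ?_, ?_, ?_, ?_⟩
  · rw [Finset.mem_insert, Finset.mem_singleton]
    rintro (rfl | rfl)
    exacts [hS hiS, hsat hiS]
  · rw [hpair, Finset.sum_pair hne, if_neg hne, if_pos rfl]
    ring
  · intro k hk
    rw [Finset.mem_sdiff, Finset.mem_insert, Finset.mem_singleton] at hk
    rcases hk.1 with rfl | rfl
    · simp only [if_neg hne, hxchall, ge_iff_le, le_refl]
    · simp only [if_true, hxsat]
      linarith
  · intro k hk
    rw [Finset.mem_inter, Finset.mem_insert, Finset.mem_singleton] at hk
    rcases hk with ⟨rfl | rfl, hkS⟩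
    exacts [absurd hkS hS, absurd hkS hsat]
end
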